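/- For M ∈ so(n) let J_M be the real linear span of the matrices π( (λI + A)^{-1} (M(λI + A)^{-1})^j ) for j ∈ ℕ and λ ∈ ℝ with λ ∉ {−α_1,…,−α_r} (the gradients of the integrals tr((M(λI+A)^{-1})^{2k}) arising from the pencil of compatible Lie brackets [·,·] and [·,·]_A on so(n)). Then there is an open dense subset U ⊆ so(n) such that for every M ∈ U the subspace J_M + so(n)_A is coisotropic with respect to the Lie–Poisson structure at M: every ξ ∈ so(n) satisfying tr(M·[ξ, η]) = 0 for all η ∈ J_M + so(n)_A belongs to J_M + so(n)_A. (Bolsinov's completeness theorem, Theorem 2 of the paper.) -/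

import Mathlib

open Matrix

/-- The skew-symmetric part `π(P) = (P − Pᵀ)/2` of a matrix. -/
noncomputable def skewPart {n : ℕ} (P : Matrix (Fin n) (Fin n) ℝ) :
    Matrix (Fin n) (Fin n) ℝ :=
  (1 / 2 : ℝ) • (P - Pᵀ)

/-- The isotropy subalgebra `so(n)_A = {X ∈ so(n) : XA = AX}`. -/
def soA {n : ℕ} (A : Matrix (Fin n) (Fin n) ℝ) : Set (Matrix (Fin n) (Fin n) ℝ) :=
  {X | Xᵀ = -X ∧ X * A = A * X}

/-- The gradients of the integrals `tr((M(λI + A)^{-1})^{2k})` arising from the pencil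
of compatible Lie brackets: the matrices `π((λI + A)^{-1}·(M(λI + A)^{-1})^j)` for
`j ∈ ℕ` and `λ ∈ ℝ` with `λ ∉ {−α 1, …, −α r}`. -/
noncomputable def pencilGradients {n r : ℕ} (α : Fin r → ℝ)
    (A M : Matrix (Fin n) (Fin n) ℝ) : Set (Matrix (Fin n) (Fin n) ℝ) :=
  {P | ∃ (lam : ℝ) (j : ℕ), (∀ p, lam ≠ -α p) ∧
    P = skewPart ((lam • (1 : Matrix (Fin n) (Fin n) ℝ) + A)⁻¹
          * (M * (lam • (1 : Matrix (Fin n) (Fin n) ℝ) + A)⁻¹) ^ j)}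

open Matrix

/-- A real function given by a polynomial. -/
def RPoly (f : ℝ → ℝ) : Prop := ∃ p : Polynomial ℝ, ∀ t, f t = p.eval t

namespace RPoly

lemma const (c : ℝ) : RPoly fun _ => c := ⟨Polynomial.C c, by simp⟩

lemma id : RPoly fun t => t := ⟨Polynomial.X, by simp⟩

lemma add {f g : ℝ → ℝ} (hf : RPoly f) (hg : RPoly g) : RPoly fun t => f t + g t := by
  obtain ⟨p, hp⟩ := hf
  obtain ⟨q, hq⟩ := hg
  exact ⟨p + q, by simp [hp, hq]⟩

lemma mul {f g : ℝ → ℝ} (hf : RPoly f) (hg : RPoly g) : RPoly fun t => f t * g t := by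
  obtain ⟨p, hp⟩ := hf
  obtain ⟨q, hq⟩ := hg
  exact ⟨p * q, by simp [hp, hq]⟩

lemma neg {f : ℝ → ℝ} (hf : RPoly f) : RPoly fun t => - f t := by
  obtain ⟨p, hp⟩ := hf
  exact ⟨-p, by simp [hp]⟩

lemma sub {f g : ℝ → ℝ} (hf : RPoly f) (hg : RPoly g) : RPoly fun t => f t - g t := by
  simpa only [sub_eq_add_neg] using hf.add hg.neg

lemma sum {κ : Type*} (s : Finset κ) {f : κ → ℝ → ℝ} (hf : ∀ i ∈ s, RPoly (f i)) :
    RPoly fun t => ∑ i ∈ s, f i t := by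
  classical
  choose! p hp using hf
  refine ⟨∑ i ∈ s, p i, fun t => ?_⟩
  rw [Polynomial.eval_finset_sum]
  exact Finset.sum_congr rfl fun i hi => hp i hi t

lemma prod {κ : Type*} (s : Finset κ) {f : κ → ℝ → ℝ} (hf : ∀ i ∈ s, RPoly (f i)) :
    RPoly fun t => ∏ i ∈ s, f i t := by
  classical
  choose! p hp using hf
  refine ⟨∏ i ∈ s, p i, fun t => ?_⟩
  rw [Polynomial.eval_prod]
  exact Finset.prod_congr rfl fun i hi => hp i hi t

lemma det {κ : Type*} [Fintype κ] [DecidableEq κ] {F : ℝ → Matrix κ κ ℝ}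
    (hF : ∀ i j, RPoly fun t => F t i j) : RPoly fun t => (F t).det := by
  simp only [Matrix.det_apply']
  exact sum _ fun σ _ => (const _).mul (prod _ fun i _ => hF _ _)

lemma adjugate {κ : Type*} [Fintype κ] [DecidableEq κ] {F : ℝ → Matrix κ κ ℝ}
    (hF : ∀ i j, RPoly fun t => F t i j) (i j : κ) : RPoly fun t => (F t).adjugate i j := by
  simp only [Matrix.adjugate_apply]
  refine det fun k l => ?_
  simp only [Matrix.updateRow_apply]
  split_ifs
  · exact const _
  · exact hF _ _

lemma matmul {κ μ ν : Type*} [Fintype κ] {F : ℝ → Matrix μ κ ℝ} {H : ℝ → Matrix κ ν ℝ}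
    (hF : ∀ i j, RPoly fun t => F t i j) (hH : ∀ i j, RPoly fun t => H t i j) (i j) :
    RPoly fun t => (F t * H t) i j := by
  simp only [Matrix.mul_apply]
  exact sum _ fun k _ => (hF _ _).mul (hH _ _)

lemma trace {κ : Type*} [Fintype κ] {F : ℝ → Matrix κ κ ℝ}
    (hF : ∀ i j, RPoly fun t => F t i j) : RPoly fun t => (F t).trace := by
  simp only [Matrix.trace, Matrix.diag_apply]
  exact sum _ fun k _ => hF _ _

lemma finite {f : ℝ → ℝ} (hf : RPoly f) {a : ℝ} (ha : f a ≠ 0) : {t | f t = 0}.Finite := by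
  obtain ⟨p, hp⟩ := hf
  have h0 : p ≠ 0 := by
    rintro rfl
    exact ha (by simp [hp])
  refine (p.roots.toFinset.finite_toSet).subset fun t ht => ?_
  simp only [Set.mem_setOf_eq, hp] at ht
  simpa [h0] using ht

lemma exists_ne2 {f g : ℝ → ℝ} (hf : RPoly f) (hg : RPoly g) {a b : ℝ} (ha : f a ≠ 0)
    (hb : g b ≠ 0) : ∃ t, f t ≠ 0 ∧ g t ≠ 0 := by
  have h := ((hf.finite ha).union (hg.finite hb)).infinite_compl.nonempty
  obtain ⟨t, ht⟩ := h
  exact ⟨t, by simpa [not_or] using ht⟩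

end RPoly

/-- The pencil `M + xA + y`. -/
noncomputable def pen {ι : Type} [DecidableEq ι] (a : ι → ℝ) (M : Matrix ι ι ℝ)
    (x y : ℝ) : Matrix ι ι ℝ := M + x • diagonal a + y • (1 : Matrix ι ι ℝ)

lemma rpoly_pen {ι : Type} [DecidableEq ι] (a : ι → ℝ) {F : ℝ → Matrix ι ι ℝ}
    (hF : ∀ i j, RPoly fun t => F t i j) {x y : ℝ → ℝ} (hx : RPoly x) (hy : RPoly y) (i j) :
    RPoly fun t => pen a (F t) (x t) (y t) i j := by
  simp only [pen, Matrix.add_apply, Matrix.smul_apply, smul_eq_mul]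
  exact ((hF i j).add (hx.mul (.const _))).add (hy.mul (.const _))

lemma rpoly_line {ι : Type} (M X : Matrix ι ι ℝ) (i j) :
    RPoly fun t => (M + t • X) i j := by
  simp only [Matrix.add_apply, Matrix.smul_apply, smul_eq_mul]
  exact (RPoly.const _).add (RPoly.id.mul (.const _))

/-- The matrix of pairings of `X i` with the adjugates at the points `(x j, y j)`. -/
noncomputable def rankMat {ι κ : Type} [Fintype ι] [DecidableEq ι] (a : ι → ℝ)
    (X : κ → Matrix ι ι ℝ) (x y : κ → ℝ) (M : Matrix ι ι ℝ) : Matrix κ κ ℝ :=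
  Matrix.of fun i j => (X i * (pen a M (x j) (y j)).adjugate).trace

def RankProp {ι : Type} [Fintype ι] [DecidableEq ι] (a : ι → ℝ) (κ : Type) [Fintype κ]
    [DecidableEq κ] : Prop :=
  ∃ M : Matrix ι ι ℝ, Mᵀ = -M ∧ ∃ X : κ → Matrix ι ι ℝ, (∀ i, (X i)ᵀ = -(X i)) ∧
    ∃ x y : κ → ℝ, (rankMat a X x y M).det ≠ 0

noncomputable def lineMat {ι κ : Type} [Fintype ι] [DecidableEq ι] (δ : ι → ℝ)
    (ψ : κ → ι → ℝ) (v : ι → ℝ) (x : κ → ℝ) (M : Matrix ι ι ℝ) : Matrix κ κ ℝ :=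
  Matrix.of fun i j => ψ i ⬝ᵥ ((pen δ M (x j) 0).adjugate *ᵥ v) +
    ψ i ⬝ᵥ (v ᵥ* (pen δ M (x j) 0).adjugate)

def LineProp {ι : Type} [Fintype ι] [DecidableEq ι] (δ : ι → ℝ) (κ : Type) [Fintype κ]
    [DecidableEq κ] : Prop :=
  ∃ M : Matrix ι ι ℝ, Mᵀ = -M ∧ ∃ (ψ : κ → ι → ℝ) (v : ι → ℝ) (x : κ → ℝ),
    (lineMat δ ψ v x M).det ≠ 0

lemma rpoly_rankMat {ι κ : Type} [Fintype ι] [DecidableEq ι] [Fintype κ] [DecidableEq κ]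
    (a : ι → ℝ) (X : κ → Matrix ι ι ℝ) {F : ℝ → Matrix ι ι ℝ}
    (hF : ∀ i j, RPoly fun t => F t i j) {x y : κ → ℝ → ℝ} (hx : ∀ j, RPoly (x j))
    (hy : ∀ j, RPoly (y j)) :
    RPoly fun t => (rankMat a X (fun j => x j t) (fun j => y j t) (F t)).det := by
  refine RPoly.det fun i j => ?_
  simp only [rankMat, Matrix.of_apply]
  refine RPoly.trace (RPoly.matmul (fun _ _ => .const _) ?_)
  exact RPoly.adjugate (rpoly_pen a hF (hx j) (hy j))

lemma rpoly_lineMat {ι κ : Type} [Fintype ι] [DecidableEq ι] [Fintype κ] [DecidableEq κ]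
    (δ : ι → ℝ) (ψ : κ → ι → ℝ) (v : ι → ℝ) (x : κ → ℝ) {F : ℝ → Matrix ι ι ℝ}
    (hF : ∀ i j, RPoly fun t => F t i j) :
    RPoly fun t => (lineMat δ ψ v x (F t)).det := by
  refine RPoly.det fun i j => ?_
  simp only [lineMat, Matrix.of_apply, dotProduct, mulVec, vecMul]
  have h := RPoly.adjugate (rpoly_pen δ hF (.const (x j)) (.const 0))
  refine (RPoly.sum _ fun k _ => (RPoly.const _).mul (RPoly.sum _ fun l _ => ?_)).add
    (RPoly.sum _ fun k _ => (RPoly.const _).mul (RPoly.sum _ fun l _ => ?_))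
  · exact (h _ _).mul (.const _)
  · exact (RPoly.const _).mul (h _ _)

lemma adj_border_col {ι : Type} [Fintype ι] [DecidableEq ι] (B : Matrix ι ι ℝ)
    (v w : ι → ℝ) (d : ℝ) (i : ι) :
    (fromBlocks B (replicateCol Unit v) (replicateRow Unit w)
      (Matrix.of fun _ _ => d)).adjugate (Sum.inl i) (Sum.inr ()) = -(B.adjugate *ᵥ v) i := by
  rw [← cramer_eq_adjugate_mulVec, cramer_apply]
  set N := fromBlocks B (replicateCol Unit v) (replicateRow Unit w) (Matrix.of fun _ _ => d)
  have h1 : N.adjugate (Sum.inl i) (Sum.inr ()) =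
      (N.adjugate *ᵥ (Pi.single (Sum.inr ()) 1)) (Sum.inl i) := by
    simp [mulVec, dotProduct, Pi.single_apply]
  rw [h1, ← cramer_eq_adjugate_mulVec, cramer_apply]
  have h2 := Matrix.det_permute' (Equiv.swap (Sum.inl i) (Sum.inr ()))
    (N.updateCol (Sum.inl i) (Pi.single (Sum.inr ()) 1))
  rw [Equiv.Perm.sign_swap (by simp)] at h2
  have h3 : (N.updateCol (Sum.inl i) (Pi.single (Sum.inr ()) 1)).submatrix _root_.id
      (Equiv.swap (Sum.inl i) (Sum.inr ())) =
      fromBlocks (B.updateCol i v) 0 (replicateRow Unit (Function.update w i d)) 1 := by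
    ext p q
    rcases q with q | q
    · by_cases hq : q = i
      · subst hq
        rcases p with p | p <;> simp [N, Matrix.updateCol_apply]
      · rw [Matrix.submatrix_apply, Equiv.swap_apply_of_ne_of_ne (by simpa using hq) (by simp)]
        rcases p with p | p <;> simp [N, Matrix.updateCol_apply, hq]
    · rcases p with p | p <;> simp [N, Matrix.updateCol_apply]
  rw [h3, det_fromBlocks_zero₁₂] at h2
  simp at h2
  linarith

lemma adj_border_row {ι : Type} [Fintype ι] [DecidableEq ι] (B : Matrix ι ι ℝ)
    (v w : ι → ℝ) (d : ℝ) (i : ι) :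
    (fromBlocks B (replicateCol Unit v) (replicateRow Unit w)
      (Matrix.of fun _ _ => d)).adjugate (Sum.inr ()) (Sum.inl i) = -(w ᵥ* B.adjugate) i := by
  have h := adj_border_col Bᵀ w v d i
  rw [← adjugate_transpose, mulVec_transpose] at h
  rw [← h]
  have h2 : (fromBlocks Bᵀ (replicateCol Unit w) (replicateRow Unit v) (Matrix.of fun _ _ => d)) =
      (fromBlocks B (replicateCol Unit v) (replicateRow Unit w) (Matrix.of fun _ _ => d))ᵀ := by
    rw [fromBlocks_transpose]
    rfl
  rw [h2, ← adjugate_transpose, Matrix.transpose_apply]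

lemma adj_border_diag {ι : Type} [Fintype ι] [DecidableEq ι] (B : Matrix ι ι ℝ)
    (d : ℝ) (i j : ι) :
    (fromBlocks B 0 0
      (Matrix.of fun _ _ => d : Matrix Unit Unit ℝ)).adjugate (Sum.inl i) (Sum.inl j)
      = d * B.adjugate i j := by
  rw [adjugate_apply, adjugate_apply]
  have : (fromBlocks B 0 0 (Matrix.of fun _ _ => d : Matrix Unit Unit ℝ)).updateRow (Sum.inl j)
      (Pi.single (Sum.inl i) 1) = fromBlocks (B.updateRow j (Pi.single i 1)) 0 0
        (Matrix.of fun _ _ => d) := by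
    ext p q
    rcases p with p | p <;> rcases q with q | q <;>
      simp [Matrix.updateRow_apply, Pi.single_apply]
  rw [this, det_fromBlocks_zero₁₂]
  simp [mul_comm]

open Matrix

lemma pen_border {ι : Type} [DecidableEq ι] (a : ι → ℝ) (b : ℝ) (M : Matrix ι ι ℝ)
    (v w : ι → ℝ) (x y : ℝ) :
    pen (Sum.elim a fun _ : Unit => b) (fromBlocks M (replicateCol Unit v)
      (replicateRow Unit w) 0) x y =
    fromBlocks (pen a M x y) (replicateCol Unit v) (replicateRow Unit w)
      (Matrix.of fun _ _ => b * x + y) := by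
  ext p q
  rcases p with p | p <;> rcases q with q | q <;>
    simp [pen, Matrix.one_apply, Matrix.diagonal_apply]
  ring

lemma pen_shift {ι : Type} [DecidableEq ι] (a : ι → ℝ) (b : ℝ) (M : Matrix ι ι ℝ) (x : ℝ) :
    pen a M x (-(b * x)) = pen (fun i => a i - b) M x 0 := by
  ext p q
  by_cases h : p = q
  · subst h; simp [pen]; ring
  · simp [pen, h]

lemma trace_border {ι : Type} [Fintype ι] [DecidableEq ι] (ψ : ι → ℝ)
    (Q : Matrix (ι ⊕ Unit) (ι ⊕ Unit) ℝ) :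
    (fromBlocks (0 : Matrix ι ι ℝ) (replicateCol Unit ψ) (replicateRow Unit (-ψ)) 0 * Q).trace =
      ∑ i, ψ i * Q (Sum.inr ()) (Sum.inl i) - ∑ i, ψ i * Q (Sum.inl i) (Sum.inr ()) := by
  simp [Matrix.trace, Matrix.mul_apply, Fintype.sum_sum_type, sub_eq_add_neg]

lemma trace_border' {ι : Type} [Fintype ι] [DecidableEq ι] (X : Matrix ι ι ℝ)
    (Q : Matrix (ι ⊕ Unit) (ι ⊕ Unit) ℝ) :
    (fromBlocks X 0 0 (0 : Matrix Unit Unit ℝ) * Q).trace = (X * Q.toBlocks₁₁).trace := by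
  simp [Matrix.trace, Matrix.mul_apply, Fintype.sum_sum_type, toBlocks₁₁]

lemma rank_step {ι : Type} [Fintype ι] [DecidableEq ι] (a : ι → ℝ) (b : ℝ) (κ κ' : Type)
    [Fintype κ] [DecidableEq κ] [Fintype κ'] [DecidableEq κ']
    (h1 : RankProp a κ) (h2 : LineProp (fun i => a i - b) κ') :
    RankProp (Sum.elim a fun _ : Unit => b) (κ ⊕ κ') := by
  obtain ⟨M1, hM1, X, hX, x, y0, h1⟩ := h1
  obtain ⟨M2, hM2, ψ, v, x', h2⟩ := h2
  obtain ⟨y, hy, h1⟩ : ∃ y : κ → ℝ, (∏ j, (b * x j + y j) ≠ 0) ∧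
      (rankMat a X x y M1).det ≠ 0 := by
    obtain ⟨t0, ht0⟩ := (Set.finite_range fun j => -(b * x j + y0 j)).infinite_compl.nonempty
    have hf : RPoly fun t => ∏ j, (b * x j + (y0 j + t)) :=
      RPoly.prod _ fun j _ => (RPoly.const _).add ((RPoly.const _).add .id)
    have hg := rpoly_rankMat a X (F := fun _ => M1) (fun _ _ => .const _)
      (x := fun j _ => x j) (y := fun j t => y0 j + t) (fun j => .const _)
      (fun j => (RPoly.const _).add .id)
    obtain ⟨t, ht1, ht2⟩ := RPoly.exists_ne2 hf hg (a := t0) (b := 0)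
      (Finset.prod_ne_zero_iff.2 fun j _ h => ht0 ⟨j, by simp only; linarith⟩) (by simpa using h1)
    exact ⟨_, ht1, ht2⟩
  obtain ⟨M, hM, h1, h2⟩ : ∃ M : Matrix ι ι ℝ, Mᵀ = -M ∧ (rankMat a X x y M).det ≠ 0 ∧
      (lineMat (fun i => a i - b) ψ v x' M).det ≠ 0 := by
    have hf := rpoly_rankMat a X (F := fun t => M1 + t • (M2 - M1)) (rpoly_line _ _)
      (x := fun j _ => x j) (y := fun j _ => y j) (fun j => .const _) (fun j => .const _)
    have hg := rpoly_lineMat (fun i => a i - b) ψ v x' (F := fun t => M1 + t • (M2 - M1))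
      (rpoly_line _ _)
    obtain ⟨t, ht1, ht2⟩ := RPoly.exists_ne2 hf hg (a := 0) (b := 1)
      (by simpa using h1) (by simpa using h2)
    refine ⟨_, ?_, ht1, ht2⟩
    rw [transpose_add, transpose_smul, transpose_sub, hM1, hM2]
    ext i j
    simp; ring
  set xx : κ ⊕ κ' → ℝ := Sum.elim x x'
  set yy : κ ⊕ κ' → ℝ := Sum.elim y (fun l => -(b * x' l))
  let MM : ℝ → Matrix (ι ⊕ Unit) (ι ⊕ Unit) ℝ := fun ε => fromBlocks M
    (replicateCol Unit (ε • v)) (replicateRow Unit (-(ε • v))) 0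
  let N : ℝ → κ ⊕ κ' → Matrix (ι ⊕ Unit) (ι ⊕ Unit) ℝ := fun ε j =>
    pen (Sum.elim a fun _ : Unit => b) (MM ε) (xx j) (yy j)
  have hMM : ∀ i j, RPoly fun ε => MM ε i j := by
    rintro (i | i) (j | j) <;> simp only [MM, fromBlocks_apply₁₁, fromBlocks_apply₁₂,
      fromBlocks_apply₂₁, fromBlocks_apply₂₂, replicateCol_apply, replicateRow_apply,
      Pi.smul_apply, Pi.neg_apply, smul_eq_mul]
    · exact .const _
    · exact RPoly.id.mul (.const _)
    · exact (RPoly.id.mul (.const _)).neg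
    · exact .const _
  have hN : ∀ j p q, RPoly fun ε => N ε j p q := fun j => rpoly_pen _ hMM (.const _) (.const _)
  let H : ℝ → Matrix (κ ⊕ κ') (κ ⊕ κ') ℝ := fun ε => Matrix.of fun i j =>
    Sum.elim (fun i => (X i * (N ε j).adjugate.toBlocks₁₁).trace)
      (fun l => ψ l ⬝ᵥ ((pen a M (xx j) (yy j)).adjugate *ᵥ v) +
        ψ l ⬝ᵥ (v ᵥ* (pen a M (xx j) (yy j)).adjugate)) i
  have hH : RPoly fun ε => (H ε).det := by
    refine RPoly.det fun i j => ?_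
    rcases i with i | i
    · simp only [H, Matrix.of_apply, Sum.elim_inl]
      refine RPoly.trace (RPoly.matmul (fun _ _ => .const _) ?_)
      intro p q
      exact RPoly.adjugate (hN j) _ _
    · exact .const _
  have hH0 : (H 0).det ≠ 0 := by
    have hblk : H 0 = fromBlocks ((rankMat a X x y M) * diagonal (fun j => b * x j + y j))
        0 (H 0).toBlocks₂₁ (lineMat (fun i => a i - b) ψ v x' M) := by
      have key : ∀ i j, (X i * (N 0 j).adjugate.toBlocks₁₁).trace =
          (b * xx j + yy j) * (X i * (pen a M (xx j) (yy j)).adjugate).trace := by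
        intro i j
        have : (N 0 j).adjugate.toBlocks₁₁ =
            (b * xx j + yy j) • (pen a M (xx j) (yy j)).adjugate := by
          ext p q
          simp only [toBlocks₁₁, Matrix.of_apply, N, MM, pen_border, Matrix.smul_apply,
            smul_eq_mul]
          rw [← adj_border_diag]
          congr 2
          all_goals (ext p q; simp)
        rw [this]
        simp
      ext i j
      rcases i with i | i <;> rcases j with j | j
      · simp only [H, Matrix.of_apply, Sum.elim_inl, key, fromBlocks_apply₁₁, mul_diagonal]
        simp [xx, yy, rankMat, mul_comm]
      · simp only [H, Matrix.of_apply, Sum.elim_inl, key, fromBlocks_apply₁₂]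
        simp [xx, yy]
      · rfl
      · simp [H, xx, yy, lineMat, pen_shift]
    rw [hblk, det_fromBlocks_zero₁₂, det_mul, det_diagonal]
    exact mul_ne_zero (mul_ne_zero h1 hy) h2
  obtain ⟨ε, hε, hHε⟩ := RPoly.exists_ne2 RPoly.id hH (a := 1) one_ne_zero hH0
  refine ⟨MM ε, ?_, Sum.elim (fun i => fromBlocks (X i) 0 0 0)
    (fun l => fromBlocks 0 (replicateCol Unit (ψ l)) (replicateRow Unit (-ψ l)) 0), ?_, xx, yy, ?_⟩
  · simp only [MM, fromBlocks_transpose, hM, fromBlocks_neg]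
    congr 1
    · ext i j; simp
    · simp
  · rintro (i | i)
    · simp [fromBlocks_transpose, hX, fromBlocks_neg]
    · simp only [Sum.elim_inr, fromBlocks_transpose, fromBlocks_neg]
      congr 1
      · simp
      · ext i j; simp
      · simp
  · have : rankMat (Sum.elim a fun _ : Unit => b) (Sum.elim (fun i => fromBlocks (X i) 0 0 0)
      (fun l => fromBlocks 0 (replicateCol Unit (ψ l)) (replicateRow Unit (-ψ l)) 0)) xx yy (MM ε)
        = diagonal (Sum.elim (fun _ => 1) (fun _ => ε)) * H ε := by
      ext i j
      rw [diagonal_mul]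
      rcases i with i | i
      · simp only [rankMat, Matrix.of_apply, Sum.elim_inl, H, N, trace_border', one_mul]
      · simp only [rankMat, Matrix.of_apply, Sum.elim_inr, H, trace_border, MM, pen_border,
          adj_border_col, adj_border_row, dotProduct]
        rw [← Finset.sum_sub_distrib, ← Finset.sum_add_distrib, Finset.mul_sum]
        refine Finset.sum_congr rfl fun k _ => ?_
        simp only [mulVec_smul, neg_vecMul, smul_vecMul, Pi.neg_apply, Pi.smul_apply, smul_eq_mul]
        ring
    rw [this, det_mul, det_diagonal]
    refine mul_ne_zero (Finset.prod_ne_zero_iff.2 ?_) hHε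
    rintro (i | i) _
    · simp
    · simpa using hε

open Matrix

/-- The skew matrix attached to an involution. -/
def pairMat {ι : Type} [DecidableEq ι] (σ : ι → ι) (w : ι → ℝ) : Matrix ι ι ℝ :=
  Matrix.of fun i j => if j = σ i then w i else 0

lemma pairMat_skew {ι : Type} [DecidableEq ι] {σ : ι → ι} {w : ι → ℝ}
    (hσ : ∀ i, σ (σ i) = i) (hw : ∀ i, w (σ i) = -w i) : (pairMat σ w)ᵀ = -pairMat σ w := by
  ext i j
  simp only [pairMat, Matrix.transpose_apply, Matrix.of_apply, Matrix.neg_apply]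
  by_cases h : j = σ i
  · subst h; simp [hσ, hw]
  · have : i ≠ σ j := fun h' => h (by rw [h', hσ])
    simp [h, this]

lemma pair_inv {ι : Type} [Fintype ι] [DecidableEq ι] {σ : ι → ι} {w : ι → ℝ}
    (hσ : ∀ i, σ (σ i) = i) (hw : ∀ i, w (σ i) = -w i) (δ : ι → ℝ) (x : ℝ)
    (hΔ : ∀ i, x ^ 2 * (δ i * δ (σ i)) + w i ^ 2 ≠ 0) :
    pen δ (pairMat σ w) x 0 * (diagonal (fun i => x * δ (σ i) / (x ^ 2 * (δ i * δ (σ i)) + w i ^ 2))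
      + pairMat σ (fun i => - w i / (x ^ 2 * (δ i * δ (σ i)) + w i ^ 2))) = 1 := by
  have e : pen δ (pairMat σ w) x 0 = diagonal (fun i => x * δ i) + pairMat σ w := by
    ext i j
    by_cases h : i = j
    · subst h; simp [pen, add_comm]
    · simp [pen, h]
  rw [e, add_mul, mul_add, mul_add]
  ext i j
  have hh : ∀ Q : Matrix ι ι ℝ, (pairMat σ w * Q) i j = w i * Q (σ i) j := by
    intro Q; simp [pairMat, Matrix.mul_apply]
  simp only [Matrix.add_apply, diagonal_mul_diagonal, diagonal_mul, hh]
  have h1 := hΔ i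
  simp only [pairMat, Matrix.of_apply, hσ, hw, Matrix.diagonal_apply, Matrix.one_apply]
  have h2 : x ^ 2 * (δ (σ i) * δ i) + (- w i) ^ 2 = x ^ 2 * (δ i * δ (σ i)) + w i ^ 2 := by ring
  rw [h2]
  by_cases hij : i = j
  · subst hij
    by_cases hs : σ i = i
    · have := hw i
      rw [hs] at this
      have h0 : w i = 0 := by linarith
      simp only [hs, h0] at h1 ⊢
      simp
      field_simp
      exact div_self (by simpa using h1)
    · have hs' : i ≠ σ i := fun h => hs h.symm
      simp [hs, hs']
      generalize hE : x ^ 2 * (δ i * δ (σ i)) + w i ^ 2 = E at h1 ⊢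
      field_simp
      rw [← hE]
      ring
  · have hji : j ≠ i := fun h => hij h.symm
    by_cases hs : j = σ i
    · have hs' : σ i = j := hs.symm
      simp [hij, hji, hs']
      field_simp
      ring
    · have hs' : σ i ≠ j := fun h => hs h.symm
      simp [hij, hji, hs', hs]

lemma pair_line {ι : Type} [Fintype ι] [DecidableEq ι] {σ : ι → ι} {w : ι → ℝ}
    (hσ : ∀ i, σ (σ i) = i) (hw : ∀ i, w (σ i) = -w i) (δ : ι → ℝ) (x : ℝ)
    (hΔ : ∀ i, x ^ 2 * (δ i * δ (σ i)) + w i ^ 2 ≠ 0) :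
    (pen δ (pairMat σ w) x 0).det ≠ 0 ∧ ∀ i,
      Pi.single i 1 ⬝ᵥ ((pen δ (pairMat σ w) x 0).adjugate *ᵥ 1) +
      Pi.single i 1 ⬝ᵥ ((1 : ι → ℝ) ᵥ* (pen δ (pairMat σ w) x 0).adjugate) =
      (pen δ (pairMat σ w) x 0).det *
        (2 * (x * δ (σ i) / (x ^ 2 * (δ i * δ (σ i)) + w i ^ 2))) := by
  have h := pair_inv hσ hw δ x hΔ
  set N := pen δ (pairMat σ w) x 0
  set C := (diagonal (fun i => x * δ (σ i) / (x ^ 2 * (δ i * δ (σ i)) + w i ^ 2))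
      + pairMat σ (fun i => - w i / (x ^ 2 * (δ i * δ (σ i)) + w i ^ 2))) with hC
  have hd : N.det ≠ 0 := by
    intro h0
    have := congrArg Matrix.det h
    rw [det_mul, h0] at this
    simp at this
  refine ⟨hd, fun i => ?_⟩
  have hadj : N.adjugate = N.det • C := by
    calc N.adjugate = N.adjugate * (N * C) := by rw [h, mul_one]
      _ = N.det • C := by rw [← mul_assoc, adjugate_mul, smul_mul, one_mul]
  rw [hadj]
  simp only [smul_mulVec, vecMul_smul, single_one_dotProduct, Pi.smul_apply, smul_eq_mul,
    ← mul_add]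
  congr 1
  rw [hC, add_mulVec, vecMul_add]
  simp only [Pi.add_apply, mulVec_diagonal, vecMul_diagonal, Pi.one_apply]
  have e1 : (pairMat σ (fun i => - w i / (x ^ 2 * (δ i * δ (σ i)) + w i ^ 2)) *ᵥ 1) i
      = - w i / (x ^ 2 * (δ i * δ (σ i)) + w i ^ 2) := by
    simp [pairMat, mulVec, dotProduct]
  have e2 : ((1 : ι → ℝ) ᵥ* pairMat σ (fun i => - w i / (x ^ 2 * (δ i * δ (σ i)) + w i ^ 2))) i
      = w i / (x ^ 2 * (δ i * δ (σ i)) + w i ^ 2) := by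
    simp only [pairMat, vecMul, dotProduct, Pi.one_apply, one_mul, Matrix.of_apply]
    rw [Finset.sum_eq_single (σ i)]
    · rw [if_pos (hσ i).symm, hσ, hw]
      congr 1
      · ring
      · ring
    · intro j _ hj
      rw [if_neg]
      intro h
      exact hj (by rw [h, hσ])
    · simp
  rw [e1, e2]
  ring

lemma pair_zero {ι : Type} [Fintype ι] [DecidableEq ι] {σ : ι → ι} {w : ι → ℝ}
    (hσ : ∀ i, σ (σ i) = i) (hw : ∀ i, w (σ i) = -w i) (i0 : ι) (h0 : σ i0 = i0)
    (hne : ∀ i, i ≠ i0 → w i ≠ 0) :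
    (pairMat σ w).adjugate i0 i0 ≠ 0 ∧ ∀ i j, (i ≠ i0 ∨ j ≠ i0) →
      (pairMat σ w).adjugate i j = 0 := by
  have hw0 : w i0 = 0 := by
    have := hw i0
    rw [h0] at this
    linarith
  constructor
  · have h := (pair_line hσ hw (Pi.single i0 1) 1 ?_).1
    · rw [adjugate_apply]
      convert! h using 2
      ext i j
      by_cases hi : i = i0
      · subst hi
        simp [pen, pairMat, h0, hw0, Matrix.updateRow_apply, Pi.single_apply,
          Matrix.diagonal_apply, eq_comm]
      · simp [pen, hi, Matrix.updateRow_apply, Matrix.diagonal_apply]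
    · intro i
      by_cases hi : i = i0
      · subst hi; simp [h0, hw0]
      · simp [hi, hne i hi]
  · intro i j hij
    rw [adjugate_apply]
    by_cases hj : j = i0
    · subst hj
      have hi : i ≠ j := by tauto
      apply det_eq_zero_of_column_eq_zero j
      intro k
      by_cases hk : k = j
      · subst hk; simp [hi.symm]
      · have : j ≠ σ k := fun h => hk (by rw [← hσ k, ← h, h0])
        simp [hk, pairMat, this]
    · apply det_eq_zero_of_row_eq_zero i0
      intro k
      have : i0 ≠ j := fun h => hj h.symm
      simp [this, pairMat, hw0]

open Polynomial in
lemma cauchy_ne_zero {κ : Type} [Fintype κ] [DecidableEq κ] (t y : κ → ℝ)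
    (ht : Function.Injective t) (hy : Function.Injective y) (h : ∀ i j, t i + y j ≠ 0) :
    (Matrix.of fun i j => 1 / (t i + y j) : Matrix κ κ ℝ).det ≠ 0 := by
  intro h0
  obtain ⟨b, hb, hbz⟩ := Matrix.exists_vecMul_eq_zero_iff.2 h0
  let P : ℝ[X] := ∑ i, C (b i) * ∏ k ∈ Finset.univ.erase i, (C (t k) + X)
  have hev : ∀ j, P.eval (y j) = 0 := by
    intro j
    have h1 := congrFun hbz j
    simp only [vecMul, dotProduct, Matrix.of_apply, Pi.zero_apply] at h1
    have : P.eval (y j) = (∏ k, (t k + y j)) * ∑ i, b i * (1 / (t i + y j)) := by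
      simp only [P, eval_finsetSum, eval_mul, eval_C, eval_prod, eval_add, eval_X, Finset.mul_sum]
      refine Finset.sum_congr rfl fun i _ => ?_
      rw [← Finset.mul_prod_erase Finset.univ _ (Finset.mem_univ i)]
      have := h i j
      field_simp
    rw [this, h1, mul_zero]
  have hdeg : P.degree < ((Finset.univ : Finset κ).card : WithBot ℕ) := by
    refine lt_of_le_of_lt (degree_sum_le _ _) ?_
    refine (Finset.sup_lt_iff (WithBot.bot_lt_coe _)).2 fun i _ => ?_
    refine lt_of_le_of_lt (degree_mul_le _ _) ?_
    have h1 : (∏ k ∈ Finset.univ.erase i, (C (t k) + X)).degree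
        ≤ ((Fintype.card κ - 1 : ℕ) : WithBot ℕ) := by
      refine (degree_prod_le _ _).trans ?_
      refine (Finset.sum_le_card_nsmul _ _ 1 fun k _ => ?_).trans ?_
      · rw [add_comm, degree_X_add_C]
      · rw [Finset.card_erase_of_mem (Finset.mem_univ i)]
        simp [Finset.card_univ]
    have h2 : (C (b i)).degree ≤ 0 := degree_C_le
    have h3 : 0 < Fintype.card κ := Fintype.card_pos_iff.2 ⟨i⟩
    refine lt_of_le_of_lt (add_le_add h2 h1) ?_
    rw [zero_add, Finset.card_univ]
    exact_mod_cast Nat.sub_lt h3 one_pos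
  have hP : P = 0 :=
    Polynomial.eq_zero_of_degree_lt_of_eval_index_eq_zero _ hy.injOn hdeg (fun j _ => hev j)
  apply hb
  ext i
  have h1 : P.eval (-t i) = b i * ∏ k ∈ Finset.univ.erase i, (t k + -t i) := by
    simp only [P, eval_finsetSum, eval_mul, eval_C, eval_prod, eval_add, eval_X]
    rw [Finset.sum_eq_single i]
    · intro j _ hj
      rw [Finset.prod_eq_zero (i := i)]
      · simp
      · simp [hj.symm]
      · simp
    · simp
  rw [hP, eval_zero] at h1
  have h2 : ∏ k ∈ Finset.univ.erase i, (t k + -t i) ≠ 0 := by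
    refine Finset.prod_ne_zero_iff.2 fun k hk h => ?_
    have hki : k ≠ i := (Finset.mem_erase.1 hk).1
    exact hki (ht (by linarith))
  simpa [h2] using h1.symm

open Matrix

lemma core_points {ι : Type} [Fintype ι] [DecidableEq ι] {σ : ι → ι} {w : ι → ℝ}
    (hσ : ∀ i, σ (σ i) = i) (hw : ∀ i, w (σ i) = -w i) (δ : ι → ℝ) (s : ℕ) (τ : Fin s → ι)
    (hz : s = 0 ∨ ∀ i, w i = 0 → δ i * δ (σ i) ≠ 0) (hτ : ∀ j, w (τ j) ≠ 0)
    (hδ : ∀ j, δ (σ (τ j)) ≠ 0)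
    (ht : Function.Injective fun j => δ (τ j) * δ (σ (τ j)) / w (τ j) ^ 2) :
    ∃ x : Fin s → ℝ,
      (lineMat δ (fun i => Pi.single (τ i) 1) 1 x (pairMat σ w)).det ≠ 0 := by
  rcases hz with rfl | hz
  · exact ⟨fun _ => 0, by simp⟩
  let t : ι → ℝ := fun i => δ i * δ (σ i) / w i ^ 2
  obtain ⟨Y, hY⟩ : ∃ Y : ℝ, ∀ i, |t i| ≤ Y :=
    ⟨∑ i, |t i|, fun i => Finset.single_le_sum (f := fun i => |t i|)
      (fun _ _ => abs_nonneg _) (Finset.mem_univ i)⟩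
  let y : Fin s → ℝ := fun j => |Y| + 1 + (j : ℕ)
  have hypos : ∀ j, 0 < y j := fun j => by positivity
  have hyY : ∀ j i, 0 < t i + y j := by
    intro j i
    have h1 := neg_abs_le (t i)
    have h2 := hY i
    have h3 := le_abs_self Y
    have h4 : (0 : ℝ) ≤ (j : ℕ) := by positivity
    simp only [y]
    linarith
  have hyinj : Function.Injective y := by
    intro i j hij
    simp only [y, add_right_inj, Nat.cast_inj] at hij
    exact Fin.ext hij
  let x : Fin s → ℝ := fun j => 1 / Real.sqrt (y j)
  have hxpos : ∀ j, x j ≠ 0 := fun j => by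
    have := Real.sqrt_pos.2 (hypos j)
    positivity
  have hx2 : ∀ j, x j ^ 2 = 1 / y j := fun j => by
    simp only [x, div_pow, one_pow, Real.sq_sqrt (hypos j).le]
  have hΔ : ∀ j i, x j ^ 2 * (δ i * δ (σ i)) + w i ^ 2 ≠ 0 := by
    intro j i
    by_cases hwi : w i = 0
    · have := hz i hwi
      rw [hwi]
      have h2 := pow_ne_zero 2 (hxpos j)
      simpa using ⟨hxpos j, by simpa using this⟩
    · have h1 : x j ^ 2 * (δ i * δ (σ i)) + w i ^ 2 = w i ^ 2 * (t i + y j) / y j := by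
        rw [hx2]
        have := (hypos j).ne'
        simp only [t]
        field_simp
      rw [h1]
      have := (hypos j).ne'
      have := (hyY j i).ne'
      positivity
  refine ⟨x, ?_⟩
  have hmat : lineMat δ (fun i => Pi.single (τ i) 1) 1 x (pairMat σ w) =
      diagonal (fun i => 2 * δ (σ (τ i)) / w (τ i) ^ 2) *
      (Matrix.of fun i j => 1 / (t (τ i) + y j)) *
      diagonal (fun j => (pen δ (pairMat σ w) (x j) 0).det * x j * y j) := by
    ext i j
    rw [mul_diagonal, diagonal_mul]
    simp only [lineMat, Matrix.of_apply]
    rw [(pair_line hσ hw δ (x j) (hΔ j)).2 (τ i)]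
    have h1 : x j ^ 2 * (δ (τ i) * δ (σ (τ i))) + w (τ i) ^ 2
        = w (τ i) ^ 2 * (t (τ i) + y j) / y j := by
      rw [hx2]
      have := (hypos j).ne'
      have := hτ i
      simp only [t]
      field_simp
    rw [h1]
    have := (hypos j).ne'
    have := (hyY j (τ i)).ne'
    have := hτ i
    field_simp
  rw [hmat, det_mul, det_mul, det_diagonal, det_diagonal]
  refine mul_ne_zero (mul_ne_zero ?_ ?_) ?_
  · refine Finset.prod_ne_zero_iff.2 fun i _ => ?_
    have := hτ i
    have := hδ i
    positivity
  · exact cauchy_ne_zero _ _ ht hyinj fun i j => (hyY j (τ i)).ne'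
  · refine Finset.prod_ne_zero_iff.2 fun j _ => ?_
    exact mul_ne_zero (mul_ne_zero (pair_line hσ hw δ (x j) (hΔ j)).1 (hxpos j)) (hypos j).ne'

lemma even_equiv {ι : Type} [Fintype ι] [DecidableEq ι] (P : ι → Prop) [DecidablePred P] (m : ℕ)
    (hm : Fintype.card ι = m * 2) : ∃ e : ι ≃ Fin m × Fin 2, ∀ i,
      P i ↔ 2 * ((e i).1 : ℕ) + ((e i).2 : ℕ) < Fintype.card {i // P i} := by
  have hc : Fintype.card {i // P i} + Fintype.card {i // ¬ P i} = m * 2 := by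
    rw [← hm, ← Fintype.card_sum]
    exact Fintype.card_congr (Equiv.sumCompl P)
  obtain ⟨e0, h0⟩ : ∃ e0 : ι ≃ Fin (m * 2), ∀ i, P i ↔ (e0 i : ℕ) < Fintype.card {i // P i} := by
   let e0 : ι ≃ Fin (m * 2) := (Equiv.sumCompl P).symm.trans
    ((Equiv.sumCongr (Fintype.equivFin _) (Fintype.equivFin _)).trans
      (finSumFinEquiv.trans (finCongr hc)))
   refine ⟨e0, ?_⟩
   intro i
   by_cases hi : P i
   · simp only [e0, Equiv.trans_apply, hi, true_iff]
     rw [Equiv.sumCompl_symm_apply_of_pos hi]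
     simp
   · simp only [e0, Equiv.trans_apply, hi, false_iff]
     rw [Equiv.sumCompl_symm_apply_of_neg hi]
     simp
  refine ⟨e0.trans finProdFinEquiv.symm, fun i => ?_⟩
  have : (e0 i : ℕ) = 2 * ((finProdFinEquiv.symm (e0 i)).1 : ℕ)
      + ((finProdFinEquiv.symm (e0 i)).2 : ℕ) := by
    have := congrArg Fin.val (finProdFinEquiv.apply_symm_apply (e0 i))
    rw [finProdFinEquiv_apply_val] at this
    omega
  rw [h0 i, Equiv.trans_apply, ← this]

lemma even_data {ι : Type} [Fintype ι] [DecidableEq ι] (δ : ι → ℝ) (m : ℕ)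
    (hm : Fintype.card ι = m * 2) :
    ∃ (σ : ι → ι) (w : ι → ℝ) (τ : Fin ((Fintype.card {i // δ i ≠ 0} + 1) / 2) → ι),
      (∀ i, σ (σ i) = i) ∧ (∀ i, w (σ i) = -w i) ∧ (∀ i, w i ≠ 0) ∧
      (∀ j, δ (σ (τ j)) ≠ 0) ∧
      Function.Injective fun j => δ (τ j) * δ (σ (τ j)) / w (τ j) ^ 2 := by
  classical
  obtain ⟨e, he⟩ := even_equiv (fun i => δ i ≠ 0) m hm
  set q := Fintype.card {i // δ i ≠ 0} with hq
  have hqm : q ≤ m * 2 := hm ▸ Fintype.card_subtype_le _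
  let c : Fin m → ℝ := fun j => δ (e.symm (j, 0)) * δ (e.symm (j, 1))
  let μ : Fin m → ℝ := fun j => if c j = 0 then 1 else Real.sqrt (|c j| / ((j : ℕ) + 1))
  have hμ : ∀ j, μ j ≠ 0 := by
    intro j
    simp only [μ]
    split_ifs with h
    · simp
    · have := abs_pos.2 h
      have : 0 < |c j| / ((j : ℕ) + 1) := by positivity
      exact (Real.sqrt_pos.2 this).ne'
  have ht : ∀ j, |c j / μ j ^ 2| = if c j = 0 then 0 else ((j : ℕ) + 1 : ℝ) := by
    intro j
    split_ifs with h
    · simp [h]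
    · have h1 := abs_pos.2 h
      have h2 : 0 < |c j| / ((j : ℕ) + 1) := by positivity
      simp only [μ, if_neg h, Real.sq_sqrt h2.le]
      rw [abs_div, abs_of_pos h2]
      field_simp
  let σ : ι → ι := fun i => e.symm ((e i).1, Fin.rev (e i).2)
  let w : ι → ℝ := fun i => (if (e i).2 = 0 then 1 else -1) * μ (e i).1
  have hs : ∀ j : Fin ((q + 1) / 2), (j : ℕ) < m := fun j => by have := j.2; omega
  let τ : Fin ((q + 1) / 2) → ι := fun j => e.symm (⟨j, hs j⟩, 1)
  have hrev : Fin.rev (1 : Fin 2) = 0 := rfl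
  refine ⟨σ, w, τ, fun i => by simp [σ], fun i => ?_, fun i => ?_, fun j => ?_, ?_⟩
  · simp only [w, σ, Equiv.apply_symm_apply]
    generalize (e i).2 = u
    have h : u = 0 ∨ u = 1 := by omega
    rcases h with rfl | rfl
    · rw [show Fin.rev (0 : Fin 2) = 1 from rfl, if_neg (by decide), if_pos rfl]; ring
    · rw [hrev, if_pos rfl, if_neg (by decide)]; ring
  · simp only [w]
    refine mul_ne_zero ?_ (hμ _)
    split_ifs <;> norm_num
  · simp only [σ, τ, Equiv.apply_symm_apply, hrev]
    rw [he]
    have := j.2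
    simp
    omega
  · intro j k hjk
    have hh : ∀ j, δ (τ j) * δ (σ (τ j)) / w (τ j) ^ 2 = c ⟨j, hs j⟩ / μ ⟨j, hs j⟩ ^ 2 := by
      intro j
      simp only [σ, τ, w, c, Equiv.apply_symm_apply, hrev]
      rw [if_neg (by decide), neg_one_mul, neg_sq, mul_comm]
    simp only [hh] at hjk
    have h1 := congrArg abs hjk
    rw [ht, ht] at h1
    have hc0 : ∀ j : Fin ((q + 1) / 2), c ⟨j, hs j⟩ = 0 → 2 * (j : ℕ) + 1 = q := by
      intro j hcj
      have hj := j.2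
      have h0 : δ (e.symm (⟨j, hs j⟩, 0)) ≠ 0 := by
        rw [he]; simp; omega
      have h1 : ¬ (δ (e.symm (⟨j, hs j⟩, 1)) ≠ 0) := by
        rcases mul_eq_zero.1 hcj with h | h
        · exact absurd h h0
        · simpa using h
      rw [he] at h1
      simp at h1
      omega
    ext
    by_cases hj : c ⟨j, hs j⟩ = 0 <;> by_cases hk : c ⟨k, hs k⟩ = 0
    · have := hc0 j hj
      have := hc0 k hk
      omega
    · rw [if_pos hj, if_neg hk] at h1
      have : (0 : ℝ) < (k : ℕ) + 1 := by positivity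
      simp only at h1
      linarith
    · rw [if_neg hj, if_pos hk] at h1
      have : (0 : ℝ) < (j : ℕ) + 1 := by positivity
      simp only at h1
      linarith
    · rw [if_neg hj, if_neg hk] at h1
      simpa using h1

open Matrix

lemma line_even {ι : Type} [Fintype ι] [DecidableEq ι] (δ : ι → ℝ) (m : ℕ)
    (hm : Fintype.card ι = m * 2) :
    LineProp δ (Fin ((Fintype.card {i // δ i ≠ 0} + 1) / 2)) := by
  obtain ⟨σ, w, τ, h1, h2, h3, h4, h5⟩ := even_data δ m hm
  obtain ⟨x, hx⟩ := core_points h1 h2 δ _ τ (Or.inr fun i hi => absurd hi (h3 i))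
    (fun j => h3 _) h4 h5
  exact ⟨pairMat σ w, pairMat_skew h1 h2, _, _, x, hx⟩

lemma single_line {ι : Type} [Fintype ι] [DecidableEq ι] (B : Matrix ι ι ℝ) (i : ι) :
    Pi.single i 1 ⬝ᵥ (B *ᵥ 1) + Pi.single i 1 ⬝ᵥ ((1 : ι → ℝ) ᵥ* B)
      = ∑ k, B i k + ∑ k, B k i := by
  rw [single_dotProduct, single_dotProduct]
  simp [mulVec, vecMul, dotProduct]

lemma line_odd {ι : Type} [Fintype ι] [DecidableEq ι] (δ : ι → ℝ) (m : ℕ) (i0 : ι)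
    (hi0 : δ i0 ≠ 0 ∨ ∀ i, δ i = 0)
    (hm : Fintype.card {i // i ≠ i0} = m * 2) :
    LineProp δ (Fin ((Fintype.card {i : {i // i ≠ i0} // δ i ≠ 0} + 1) / 2) ⊕ Unit) := by
  have hd := even_data (fun i : {i // i ≠ i0} => δ i) m hm
  generalize hs : (Fintype.card {i : {i // i ≠ i0} // δ i ≠ 0} + 1) / 2 = s at hd ⊢
  obtain ⟨σ', w', τ', h1, h2, h3, h4, h5⟩ := hd
  let σ : ι → ι := fun i => if h : i ≠ i0 then σ' ⟨i, h⟩ else i0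
  let w : ι → ℝ := fun i => if h : i ≠ i0 then w' ⟨i, h⟩ else 0
  have σ1 : ∀ i : {i // i ≠ i0}, σ i = σ' i := fun i => by simp [σ, i.2]
  have w1 : ∀ i : {i // i ≠ i0}, w i = w' i := fun i => by simp [w, i.2]
  have σ0 : σ i0 = i0 := by simp [σ]
  have w0 : w i0 = 0 := by simp [w]
  have hσ : ∀ i, σ (σ i) = i := by
    intro i
    by_cases h : i = i0
    · rw [h, σ0, σ0]
    · have := σ1 ⟨i, h⟩
      simp only at this
      rw [this, σ1, h1]
  have hw : ∀ i, w (σ i) = - w i := by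
    intro i
    by_cases h : i = i0
    · rw [h, σ0, w0, neg_zero]
    · have e1 := σ1 ⟨i, h⟩
      have e2 := w1 ⟨i, h⟩
      simp only at e1 e2
      rw [e1, w1, h2, e2]
  have hne : ∀ i, i ≠ i0 → w i ≠ 0 := fun i h => by
    have e2 := w1 ⟨i, h⟩
    simp only at e2
    rw [e2]; exact h3 _
  obtain ⟨x, hx⟩ := core_points hσ hw δ s (fun j => (τ' j : ι)) (by
      rcases hi0 with h | h
      · right
        intro i hi
        have : i = i0 := by by_contra h'; exact hne i h' hi
        rw [this, σ0]
        exact mul_ne_zero h h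
      · left
        have : IsEmpty {i : {i // i ≠ i0} // δ i ≠ 0} := ⟨fun i => i.2 (h _)⟩
        rw [← hs, Fintype.card_eq_zero])
    (fun j => by rw [w1]; exact h3 _) (fun j => by rw [σ1]; exact h4 j)
    (by simpa only [σ1, w1] using h5)
  refine ⟨pairMat σ w, pairMat_skew hσ hw,
    Sum.elim (fun i => Pi.single (τ' i : ι) 1) (fun _ => Pi.single i0 1), 1,
    Sum.elim x (fun _ => 0), ?_⟩
  obtain ⟨z1, z2⟩ := pair_zero hσ hw i0 σ0 hne
  have hp : pen δ (pairMat σ w) 0 0 = pairMat σ w := by simp [pen]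
  have hM : lineMat δ (Sum.elim (fun i => Pi.single (τ' i : ι) 1) (fun _ : Unit => Pi.single i0 1)) 1
      (Sum.elim x (fun _ : Unit => 0)) (pairMat σ w) = fromBlocks
        (lineMat δ (fun i => Pi.single (τ' i : ι) 1) 1 x (pairMat σ w)) 0
        (Matrix.of fun _ j => lineMat δ (fun _ : Fin s => Pi.single i0 1) 1 x (pairMat σ w) j j)
        (Matrix.of fun _ _ => 2 * (pairMat σ w).adjugate i0 i0) := by
    ext i j
    rcases i with i | i <;> rcases j with j | j
    · simp [lineMat]
    · simp only [lineMat, Matrix.of_apply, Sum.elim_inl, Sum.elim_inr, hp, fromBlocks_apply₁₂,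
        single_line, Matrix.zero_apply]
      rw [Finset.sum_eq_zero fun k _ => z2 _ _ (Or.inl (τ' i).2),
        Finset.sum_eq_zero fun k _ => z2 _ _ (Or.inr (τ' i).2), add_zero]
    · simp [lineMat]
    · simp only [lineMat, Matrix.of_apply, Sum.elim_inr, hp, fromBlocks_apply₂₂,
        single_line]
      rw [Finset.sum_eq_single i0 (fun k _ h => z2 _ _ (Or.inr h)) (by simp),
        Finset.sum_eq_single i0 (fun k _ h => z2 _ _ (Or.inl h)) (by simp), two_mul]
  rw [hM, det_fromBlocks_zero₁₂]
  refine mul_ne_zero hx ?_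
  rw [det_unique]
  exact mul_ne_zero two_ne_zero z1

lemma line_prop {ι : Type} [Fintype ι] [DecidableEq ι] (δ : ι → ℝ) :
    ∃ s : ℕ, (∃ (κ : Type) (_ : Fintype κ) (_ : DecidableEq κ), Fintype.card κ = s ∧
      LineProp δ κ) ∧ (Fintype.card ι + 1) / 2 ≤ s + (Fintype.card {i // δ i = 0}) / 2 := by
  classical
  have hc : Fintype.card {i // δ i = 0} + Fintype.card {i // δ i ≠ 0} = Fintype.card ι := by
    rw [← Fintype.card_sum]
    exact Fintype.card_congr (Equiv.sumCompl _)
  rcases Nat.even_or_odd' (Fintype.card ι) with ⟨m, hm | hm⟩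
  · refine ⟨_, ⟨_, inferInstance, inferInstance, rfl, line_even δ m (by omega)⟩, ?_⟩
    rw [Fintype.card_fin]
    omega
  · obtain ⟨i0, hi0⟩ : ∃ i0, δ i0 ≠ 0 ∨ ∀ i, δ i = 0 := by
      by_cases h : ∃ i, δ i ≠ 0
      · obtain ⟨i, hi⟩ := h
        exact ⟨i, Or.inl hi⟩
      · have : 0 < Fintype.card ι := by omega
        obtain ⟨i⟩ := Fintype.card_pos_iff.1 this
        exact ⟨i, Or.inr (by simpa using h)⟩
    have hc1 : Fintype.card {i // i ≠ i0} = m * 2 := by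
      rw [Fintype.card_subtype_compl]
      simp
      omega
    refine ⟨_, ⟨_, inferInstance, inferInstance, rfl, line_odd δ m i0 hi0 hc1⟩, ?_⟩
    rw [Fintype.card_sum, Fintype.card_fin, Fintype.card_unit]
    have : Fintype.card {i // δ i ≠ 0} ≤ Fintype.card {i : {i // i ≠ i0} // δ i ≠ 0} + 1 := by
      rw [← Fintype.card_option]
      refine Fintype.card_le_of_injective (fun i : {i // δ i ≠ 0} =>
        if h : (i : ι) ≠ i0 then some ⟨⟨i, h⟩, i.2⟩ else none) ?_
      intro i j hij
      simp only at hij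
      split_ifs at hij with h h'
      · simp at hij
        exact Subtype.ext hij
      · exact Subtype.ext ((not_ne_iff.1 h).trans (not_ne_iff.1 (by assumption)).symm)
    rcases hi0 with h | h
    · omega
    · have : IsEmpty {i // δ i ≠ 0} := ⟨fun i => i.2 (h _)⟩
      have := Fintype.card_eq_zero (α := {i // δ i ≠ 0})
      omega

open Matrix

lemma rankProp_equiv {ι ι' : Type} [Fintype ι] [DecidableEq ι] [Fintype ι'] [DecidableEq ι']
    (e : ι ≃ ι') (a : ι' → ℝ) (κ : Type) [Fintype κ] [DecidableEq κ]
    (h : RankProp (fun i => a (e i)) κ) : RankProp a κ := by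
  obtain ⟨M, hM, X, hX, x, y, hd⟩ := h
  refine ⟨M.submatrix e.symm e.symm, ?_, fun i => (X i).submatrix e.symm e.symm, fun i => ?_,
    x, y, ?_⟩
  · rw [transpose_submatrix, hM]; rfl
  · rw [transpose_submatrix, hX]; rfl
  · convert hd using 2
    ext i j
    simp only [rankMat, Matrix.of_apply]
    have : pen a (M.submatrix e.symm e.symm) (x j) (y j)
        = (pen (fun i => a (e i)) M (x j) (y j)).submatrix e.symm e.symm := by
      ext k l
      by_cases hkl : k = l
      · subst hkl; simp [pen]
      · simp [pen, hkl]
    rw [this, adjugate_submatrix_equiv_self, submatrix_mul_equiv]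
    simp only [Matrix.trace, Matrix.diag_apply, Matrix.submatrix_apply]
    exact Equiv.sum_comp e.symm (fun k => (X i * (pen (fun i => a (e i)) M (x j) (y j)).adjugate) k k)

lemma sum_bump {r : ℕ} (f : ℕ → ℕ) (k : Fin r → ℕ) (p0 : Fin r) :
    ∑ p, f (k p + if p0 = p then 1 else 0) + f (k p0) = ∑ p, f (k p) + f (k p0 + 1) := by
  rw [← Finset.add_sum_erase _ _ (Finset.mem_univ p0),
    ← Finset.add_sum_erase _ (fun p => f (k p)) (Finset.mem_univ p0)]
  have : ∑ p ∈ Finset.univ.erase p0, f (k p + if p0 = p then 1 else 0)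
      = ∑ p ∈ Finset.univ.erase p0, f (k p) :=
    Finset.sum_congr rfl fun p hp => by
      rw [if_neg (Finset.ne_of_mem_erase hp).symm, add_zero]
  rw [this, if_pos rfl]
  omega

lemma rank_main {r : ℕ} (α : Fin r → ℝ) (hα : Function.Injective α) (n : ℕ) :
    ∀ (blk : Fin n → Fin r), ∃ (κ : Type) (_ : Fintype κ) (_ : DecidableEq κ),
      RankProp (fun i => α (blk i)) κ ∧
      n.choose 2 + n / 2 + ∑ p, (Finset.univ.filter fun i => blk i = p).card / 2 ≤
        2 * Fintype.card κ + ∑ p, (Finset.univ.filter fun i => blk i = p).card.choose 2 := by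
  induction n with
  | zero =>
    intro blk
    refine ⟨Fin 0, inferInstance, inferInstance, ⟨0, by simp, fun _ => 0, by simp, fun _ => 0,
      fun _ => 0, by simp⟩, by simp⟩
  | succ n ih =>
    intro blk
    obtain ⟨κ, i1, i2, hR, hκ⟩ := ih (fun i => blk i.castSucc)
    obtain ⟨s, ⟨κ', i3, i4, hs, hL⟩, hle⟩ :=
      line_prop (fun i : Fin n => α (blk i.castSucc) - α (blk (Fin.last n)))
    let e : Fin n ⊕ Unit ≃ Fin (n + 1) :=
      (Equiv.sumCongr (Equiv.refl _) (Equiv.ofUnique Unit (Fin 1))).trans finSumFinEquiv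
    have hstep := rank_step (fun i : Fin n => α (blk i.castSucc)) (α (blk (Fin.last n))) κ κ' hR hL
    refine ⟨κ ⊕ κ', inferInstance, inferInstance, rankProp_equiv e _ _ ?_, ?_⟩
    · convert hstep using 1
      ext i
      rcases i with i | i
      · rfl
      · rfl
    · have hk : ∀ p, (Finset.univ.filter fun i => blk i = p).card =
          (Finset.univ.filter fun i : Fin n => blk i.castSucc = p).card +
            if blk (Fin.last n) = p then 1 else 0 := by
        intro p
        rw [Finset.card_filter, Finset.card_filter, Fin.sum_univ_castSucc]
      simp only [hk]
      have b1 := sum_bump (fun x => x / 2)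
        (fun p => (Finset.univ.filter fun i : Fin n => blk i.castSucc = p).card) (blk (Fin.last n))
      have b2 := sum_bump (fun x => x.choose 2)
        (fun p => (Finset.univ.filter fun i : Fin n => blk i.castSucc = p).card) (blk (Fin.last n))
      have hz : Fintype.card {i : Fin n // α (blk i.castSucc) - α (blk (Fin.last n)) = 0} =
          (Finset.univ.filter fun i : Fin n => blk i.castSucc = blk (Fin.last n)).card := by
        rw [Fintype.card_subtype]
        congr 1
        ext i
        simp [sub_eq_zero, hα.eq_iff]
      rw [hz, Fintype.card_fin] at hle
      generalize (Finset.univ.filter fun i : Fin n =>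
        blk i.castSucc = blk (Fin.last n)).card = k at *
      rw [Nat.choose_succ_succ' k 1, Nat.choose_one_right] at b2
      rw [Fintype.card_sum, hs, Nat.choose_succ_succ' n 1, Nat.choose_one_right]
      norm_num at b2 hκ hle ⊢
      omega

open Matrix

lemma minor_exists_aux {V W : Type} [AddCommGroup V] [Module ℝ V] [FiniteDimensional ℝ V]
    [AddCommGroup W] [Module ℝ W] (f : V →ₗ[ℝ] W) (ev : W →ₗ[ℝ] V →ₗ[ℝ] ℝ)
    (hev : ∀ w, (∀ v, ev w v = 0) → w = 0) :
    ∃ (d : ℕ) (ξ η : Fin d → V), Module.finrank ℝ V = d + Module.finrank ℝ (LinearMap.ker f) ∧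
      (Matrix.of fun i j => ev (f (ξ i)) (η j)).det ≠ 0 := by
  refine ⟨Module.finrank ℝ (LinearMap.range f), ?_⟩
  let b := Module.finBasis ℝ (LinearMap.range f)
  have hb : ∀ i, ∃ x, f x = b i := fun i => (b i).2
  choose ξ hξ using hb
  let g : V →ₗ[ℝ] (Fin (Module.finrank ℝ (LinearMap.range f)) → ℝ) :=
    LinearMap.pi fun i => ev (f (ξ i))
  have hg : LinearMap.range g = ⊤ := by
    by_contra hne
    obtain ⟨φ, hφ0, hφ⟩ := Submodule.exists_le_ker_of_lt_top _ (lt_top_iff_ne_top.2 hne)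
    have hli := b.linearIndependent
    rw [Fintype.linearIndependent_iff] at hli
    have key : ∀ i, φ (Pi.single i 1) = 0 := by
      refine hli (fun i => φ (Pi.single i 1)) ?_
      apply Subtype.ext
      refine hev _ fun v => ?_
      have h1 : φ (g v) = 0 := hφ ⟨v, rfl⟩
      rw [pi_eq_sum_univ (g v)] at h1
      simp only [map_sum, map_smul] at h1
      simp only [Submodule.coe_sum, Submodule.coe_smul, map_sum, map_smul, LinearMap.sum_apply,
        LinearMap.smul_apply]
      rw [← h1]
      refine Finset.sum_congr rfl fun i _ => ?_
      rw [← hξ, smul_eq_mul, smul_eq_mul, mul_comm]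
      have e : (fun j => if i = j then (1 : ℝ) else 0) = Pi.single i 1 := by
        ext j; simp [Pi.single_apply, eq_comm]
      simp only [e]
      rfl
    apply hφ0
    ext i
    simpa using key i
  have hsurj : ∀ j, ∃ v, g v = Pi.single j 1 := fun j => by
    have : Pi.single j 1 ∈ LinearMap.range g := hg ▸ Submodule.mem_top
    exact this
  choose η hη using hsurj
  refine ⟨ξ, η, (LinearMap.finrank_range_add_finrank_ker f).symm, ?_⟩
  have : (Matrix.of fun i j => ev (f (ξ i)) (η j)) = 1 := by
    ext i j
    have := congrFun (hη j) i
    simp only [g, LinearMap.pi_apply] at this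
    rw [Matrix.of_apply, this, Matrix.one_apply, Pi.single_apply]
  rw [this, det_one]
  exact one_ne_zero

lemma minor_exists {V : Type} [AddCommGroup V] [Module ℝ V] [FiniteDimensional ℝ V]
    (f : V →ₗ[ℝ] V →ₗ[ℝ] ℝ) :
    ∃ (d : ℕ) (ξ η : Fin d → V), Module.finrank ℝ V = d + Module.finrank ℝ (LinearMap.ker f) ∧
      (Matrix.of fun i j => f (ξ i) (η j)).det ≠ 0 :=
  minor_exists_aux f LinearMap.id fun w hw => LinearMap.ext hw

lemma lin_indep_of_det {V κ : Type} [AddCommGroup V] [Module ℝ V] [Fintype κ] [DecidableEq κ]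
    (ξ : κ → V) (g : κ → V →ₗ[ℝ] ℝ)
    (h : (Matrix.of fun i j => g j (ξ i)).det ≠ 0) : LinearIndependent ℝ ξ := by
  rw [Fintype.linearIndependent_iff]
  intro c hc
  have : c ᵥ* (Matrix.of fun i j => g j (ξ i)) = 0 := by
    ext j
    have := congrArg (g j) hc
    simpa [vecMul, dotProduct] using this
  have h2 := Matrix.eq_zero_of_vecMul_eq_zero h this
  exact fun i => congrFun h2 i

lemma minor_bound_aux {V W : Type} [AddCommGroup V] [Module ℝ V] [FiniteDimensional ℝ V]
    [AddCommGroup W] [Module ℝ W] (f : V →ₗ[ℝ] W) (d : ℕ) (ξ : Fin d → V)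
    (g : Fin d → W →ₗ[ℝ] ℝ)
    (h : (Matrix.of fun i j => g j (f (ξ i))).det ≠ 0) :
    d + Module.finrank ℝ (LinearMap.ker f) ≤ Module.finrank ℝ V := by
  rw [← LinearMap.finrank_range_add_finrank_ker f]
  have hli : LinearIndependent ℝ (fun i => (⟨f (ξ i), ξ i, rfl⟩ : LinearMap.range f)) :=
    lin_indep_of_det _ (fun j => (g j).comp (LinearMap.range f).subtype) h
  have := hli.fintype_card_le_finrank
  rw [Fintype.card_fin] at this
  omega

lemma minor_bound {V : Type} [AddCommGroup V] [Module ℝ V] [FiniteDimensional ℝ V]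
    (f : V →ₗ[ℝ] V →ₗ[ℝ] ℝ) (d : ℕ) (ξ η : Fin d → V)
    (h : (Matrix.of fun i j => f (ξ i) (η j)).det ≠ 0) :
    d + Module.finrank ℝ (LinearMap.ker f) ≤ Module.finrank ℝ V :=
  minor_bound_aux f d ξ (fun j => LinearMap.applyₗ (η j)) h

noncomputable def omegaV {n : ℕ} (V : Submodule ℝ (Matrix (Fin n) (Fin n) ℝ))
    (M : Matrix (Fin n) (Fin n) ℝ) : V →ₗ[ℝ] V →ₗ[ℝ] ℝ :=
  LinearMap.mk₂ ℝ (fun X Y => (M * (X.1 * Y.1 - Y.1 * X.1)).trace)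
    (fun X Y Z => by
      simp only [Submodule.coe_add, ← Matrix.trace_add]; congr 1; noncomm_ring)
    (fun c X Y => by
      simp [← smul_sub])
    (fun X Y Z => by
      simp only [Submodule.coe_add, ← Matrix.trace_add]; congr 1; noncomm_ring)
    (fun c X Y => by
      simp [← smul_sub])

lemma omegaV_apply {n : ℕ} (V : Submodule ℝ (Matrix (Fin n) (Fin n) ℝ))
    (M : Matrix (Fin n) (Fin n) ℝ) (X Y : V) :
    omegaV V M X Y = (M * (X.1 * Y.1 - Y.1 * X.1)).trace := rfl

def soB {n : ℕ} {β : Type} (blk : Fin n → β) : Submodule ℝ (Matrix (Fin n) (Fin n) ℝ) where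
  carrier := {X | Xᵀ = -X ∧ ∀ i j, blk i ≠ blk j → X i j = 0}
  add_mem' := by
    rintro X Y ⟨h1, h2⟩ ⟨h3, h4⟩
    refine ⟨by rw [transpose_add, h1, h3, neg_add], fun i j h => ?_⟩
    rw [Matrix.add_apply, h2 i j h, h4 i j h, add_zero]
  zero_mem' := by simp
  smul_mem' := by
    rintro c X ⟨h1, h2⟩
    refine ⟨by rw [transpose_smul, h1, smul_neg], fun i j h => ?_⟩
    rw [Matrix.smul_apply, h2 i j h, smul_zero]

lemma mem_soB {n : ℕ} {β : Type} {blk : Fin n → β} {X : Matrix (Fin n) (Fin n) ℝ} :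
    X ∈ soB blk ↔ Xᵀ = -X ∧ ∀ i j, blk i ≠ blk j → X i j = 0 := Iff.rfl

lemma card_lt_pairs {n : ℕ} (s : Finset (Fin n)) :
    (s.offDiag.filter fun p => p.1 < p.2).card = s.card.choose 2 := by
  have h1 : (s.offDiag.filter fun p => p.1 < p.2).card
      = (s.offDiag.filter fun p => ¬ p.1 < p.2).card := by
    refine Finset.card_bij (fun p _ => p.swap) ?_ ?_ ?_
    · rintro ⟨i, j⟩ h
      simp only [Finset.mem_filter, Finset.mem_offDiag, Prod.swap] at h ⊢
      exact ⟨⟨h.1.2.1, h.1.1, h.1.2.2.symm⟩, by omega⟩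
    · rintro ⟨i, j⟩ _ ⟨k, l⟩ _ h
      simp only [Prod.swap, Prod.mk.injEq] at h
      rw [h.1, h.2]
    · rintro ⟨i, j⟩ h
      simp only [Finset.mem_filter, Finset.mem_offDiag] at h
      refine ⟨(j, i), ?_, rfl⟩
      simp only [Finset.mem_filter, Finset.mem_offDiag]
      exact ⟨⟨h.1.2.1, h.1.1, h.1.2.2.symm⟩, by omega⟩
  have h2 := Finset.card_filter_add_card_filter_not (s := s.offDiag) (fun p => p.1 < p.2)
  rw [Finset.offDiag_card] at h2
  rw [Nat.choose_two_right, Nat.mul_sub_one]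
  omega

lemma finrank_soB {n : ℕ} {β : Type} [Fintype β] [DecidableEq β] (blk : Fin n → β) :
    Module.finrank ℝ (soB blk) = ∑ p, (Finset.univ.filter fun i => blk i = p).card.choose 2 := by
  let T := {q : Fin n × Fin n // q.1 < q.2 ∧ blk q.1 = blk q.2}
  have e : soB blk ≃ₗ[ℝ] (T → ℝ) :=
    { toFun := fun X q => X.1 q.1.1 q.1.2
      map_add' := fun X Y => rfl
      map_smul' := fun c X => rfl
      invFun := fun f => ⟨Matrix.of fun i j =>
          if h : i < j ∧ blk i = blk j then f ⟨(i, j), h⟩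
          else if h : j < i ∧ blk j = blk i then - f ⟨(j, i), h⟩ else 0, by
        rw [mem_soB]
        constructor
        · ext i j
          simp only [Matrix.transpose_apply, Matrix.of_apply, Matrix.neg_apply]
          by_cases h : blk i = blk j
          · rcases lt_trichotomy i j with h1 | h1 | h1
            · simp [h1, h, h1.not_gt]
            · subst h1; simp
            · simp [h1, h, h1.not_gt]
          · simp [h, Ne.symm h]
        · intro i j h
          simp [h, Ne.symm h]⟩
      left_inv := by
        intro X
        obtain ⟨X, h1, h2⟩ := X
        ext i j
        have h1' : X j i = - X i j := by
          have := congrFun (congrFun h1 i) j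
          simpa using this
        simp only [Matrix.of_apply]
        by_cases h : blk i = blk j
        · rcases lt_trichotomy i j with h3 | h3 | h3
          · simp [h3, h]
          · subst h3; simp; linarith
          · simp [h3, h, h3.not_gt, h1']
        · simp [h, Ne.symm h, h2 i j h]
      right_inv := by
        intro f
        ext ⟨⟨i, j⟩, h⟩
        simp only at h
        simp [h] }
  rw [e.finrank_eq, Module.finrank_fintype_fun_eq_card, Fintype.card_subtype]
  rw [Finset.card_eq_sum_card_fiberwise (t := Finset.univ) (f := fun q => blk q.1)
    (fun _ _ => Finset.mem_coe.2 (Finset.mem_univ _))]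
  refine Finset.sum_congr rfl fun p _ => ?_
  rw [← card_lt_pairs]
  congr 1
  ext ⟨i, j⟩
  simp only [Finset.mem_filter, Finset.mem_univ, true_and, Finset.mem_offDiag]
  constructor
  · rintro ⟨⟨h1, h2⟩, h3⟩
    exact ⟨⟨h3, h2 ▸ h3, h1.ne⟩, h1⟩
  · rintro ⟨⟨h1, h2, h3⟩, h4⟩
    exact ⟨⟨h4, h1.trans h2.symm⟩, h1⟩

open Matrix

lemma good_invol {n : ℕ} {β : Type} [DecidableEq β] (blk : Fin n → β) :
    ∃ σ : Fin n → Fin n, (∀ i, σ (σ i) = i) ∧ (∀ i, blk (σ i) = blk i) ∧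
      ∀ i j, σ i = i → σ j = j → blk i = blk j → i = j := by
  let S : Finset (Fin n → Fin n) :=
    Finset.univ.filter fun σ => (∀ i, σ (σ i) = i) ∧ (∀ i, blk (σ i) = blk i)
  have hS : S.Nonempty := ⟨id, by simp [S]⟩
  obtain ⟨σ, hσS, hmin⟩ := Finset.exists_min_image S
    (fun σ => (Finset.univ.filter fun i => σ i = i).card) hS
  simp only [S, Finset.mem_filter, Finset.mem_univ, true_and] at hσS hmin
  refine ⟨σ, hσS.1, hσS.2, fun i j hi hj hb => ?_⟩
  by_contra hij
  have hinj : ∀ k l, σ k = σ l → k = l := fun k l h => by rw [← hσS.1 k, h, hσS.1]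
  let σ' : Fin n → Fin n := fun k => if k = i then j else if k = j then i else σ k
  have h1 : σ' i = j := by simp [σ']
  have h2 : σ' j = i := by simp [σ', Ne.symm hij]
  have h3 : ∀ k, k ≠ i → k ≠ j → σ' k = σ k := fun k h h' => by simp [σ', h, h']
  have hlt : (Finset.univ.filter fun k => σ' k = k).card
      < (Finset.univ.filter fun k => σ k = k).card := by
    apply Finset.card_lt_card
    rw [Finset.ssubset_iff_of_subset]
    · refine ⟨i, by simpa using hi, ?_⟩
      simp [h1, Ne.symm hij]
    · intro k hk
      simp only [Finset.mem_filter, Finset.mem_univ, true_and] at hk ⊢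
      by_cases hki : k = i
      · rw [hki, hi]
      · by_cases hkj : k = j
        · rw [hkj, hj]
        · rwa [← h3 k hki hkj]
  refine absurd (hmin σ' ⟨fun k => ?_, fun k => ?_⟩) (not_le.2 hlt)
  · by_cases hki : k = i
    · rw [hki, h1, h2]
    · by_cases hkj : k = j
      · rw [hkj, h2, h1]
      · rw [h3 k hki hkj, h3 _ (fun h => hki (hinj _ _ (h.trans hi.symm)))
          (fun h => hkj (hinj _ _ (h.trans hj.symm))), hσS.1]
  · by_cases hki : k = i
    · rw [hki, h1, hb]
    · by_cases hkj : k = j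
      · rw [hkj, h2, hb]
      · rw [h3 k hki hkj, hσS.2]

lemma card_lt_invol {n : ℕ} {β : Type} [Fintype β] [DecidableEq β] (blk : Fin n → β)
    (σ : Fin n → Fin n) (hσ : ∀ i, σ (σ i) = i) (hb : ∀ i, blk (σ i) = blk i) :
    Fintype.card {i // i < σ i} ≤ ∑ p, (Finset.univ.filter fun i => blk i = p).card / 2 := by
  rw [Fintype.card_subtype,
    Finset.card_eq_sum_card_fiberwise (t := Finset.univ) (f := blk)
    (fun _ _ => Finset.mem_coe.2 (Finset.mem_univ _))]
  refine Finset.sum_le_sum fun p _ => ?_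
  rw [Nat.le_div_iff_mul_le two_pos, mul_two]
  set S := (Finset.univ.filter fun i => i < σ i).filter fun i => blk i = p with hS
  have hinj : Function.Injective σ := fun k l h => by rw [← hσ k, h, hσ]
  have h1 : (S.image σ).card = S.card := Finset.card_image_of_injective _ hinj
  have hdis : Disjoint S (S.image σ) := by
    rw [Finset.disjoint_left]
    intro i hi hi'
    obtain ⟨j, hj, rfl⟩ := Finset.mem_image.1 hi'
    simp only [hS, Finset.mem_filter, Finset.mem_univ, true_and, hσ] at hi hj
    exact absurd hi.1 (not_lt.2 hj.1.le)
  have h2 : (S ∪ S.image σ).card = S.card + S.card := by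
    rw [Finset.card_union_of_disjoint hdis, h1]
  rw [← h2]
  apply Finset.card_le_card
  intro i hi
  rcases Finset.mem_union.1 hi with h | h
  · simp only [hS, Finset.mem_filter, Finset.mem_univ, true_and] at h ⊢
    exact h.2
  · obtain ⟨j, hj, rfl⟩ := Finset.mem_image.1 h
    simp only [hS, Finset.mem_filter, Finset.mem_univ, true_and] at hj ⊢
    rw [hb, hj.2]

lemma comm_mem_soB {n : ℕ} {β : Type} {blk : Fin n → β} {X Y : Matrix (Fin n) (Fin n) ℝ}
    (hX : X ∈ soB blk) (hY : Y ∈ soB blk) : X * Y - Y * X ∈ soB blk := by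
  rw [mem_soB] at *
  refine ⟨?_, fun i j h => ?_⟩
  · rw [transpose_sub, transpose_mul, transpose_mul, hX.1, hY.1]
    noncomm_ring
  · have : ∀ X Y : Matrix (Fin n) (Fin n) ℝ, (∀ i j, blk i ≠ blk j → X i j = 0) →
        (∀ i j, blk i ≠ blk j → Y i j = 0) → (X * Y) i j = 0 := by
      intro X Y hX hY
      rw [mul_apply]
      refine Finset.sum_eq_zero fun k _ => ?_
      by_cases hk : blk i = blk k
      · rw [hY k j (hk ▸ h), mul_zero]
      · rw [hX i k hk, zero_mul]
    rw [Matrix.sub_apply, this X Y hX.2 hY.2, this Y X hY.2 hX.2, sub_zero]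

lemma skew_sq_zero {n : ℕ} {Z : Matrix (Fin n) (Fin n) ℝ} (hZ : Zᵀ = -Z)
    (h : (Z * Z).trace = 0) : Z = 0 := by
  have h1 : (Zᵀ * Z).trace = 0 := by rw [hZ, neg_mul, trace_neg, h, neg_zero]
  have := Matrix.trace_conjTranspose_mul_self_eq_zero_iff (A := Z)
  rw [conjTranspose_eq_transpose_of_trivial] at this
  exact this.1 h1

lemma rad_comm {n : ℕ} {β : Type} {blk : Fin n → β} {M : Matrix (Fin n) (Fin n) ℝ}
    (hM : M ∈ soB blk) (X : soB blk) (hX : X ∈ LinearMap.ker (omegaV (soB blk) M)) :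
    M * X.1 = X.1 * M := by
  have h1 : omegaV (soB blk) M X ⟨_, comm_mem_soB hM X.2⟩ = 0 := by
    rw [LinearMap.mem_ker.1 hX]; rfl
  rw [omegaV_apply] at h1
  simp only at h1
  have h2 : ((M * X.1 - X.1 * M) * (M * X.1 - X.1 * M)).trace = 0 := by
    rw [← h1, mul_sub M, trace_sub, sub_mul, trace_sub]
    congr 1
    · rw [mul_assoc]
    · rw [mul_assoc, Matrix.trace_mul_comm, ← mul_assoc]
  have := skew_sq_zero (comm_mem_soB hM X.2).1 h2
  exact sub_eq_zero.1 this

lemma finrank_le_aux {W κ : Type} [AddCommGroup W] [Module ℝ W] [Fintype κ]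
    (S : Submodule ℝ W) (L : W →ₗ[ℝ] (κ → ℝ)) (h : ∀ x ∈ S, L x = 0 → x = 0) :
    Module.finrank ℝ S ≤ Fintype.card κ := by
  have hL : Function.Injective (L.domRestrict S) := by
    refine (injective_iff_map_eq_zero _).2 fun x hx => Subtype.ext (h x.1 x.2 hx)
  have := LinearMap.finrank_le_finrank_of_injective hL
  rwa [Module.finrank_fintype_fun_eq_card] at this

lemma generic_elem {n : ℕ} {β : Type} [Fintype β] [DecidableEq β] (blk : Fin n → β) :
    ∃ M ∈ soB blk, Module.finrank ℝ (LinearMap.ker (omegaV (soB blk) M)) ≤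
      ∑ p, (Finset.univ.filter fun i => blk i = p).card / 2 := by
  obtain ⟨σ, hσ, hb, hf⟩ := good_invol blk
  let w : Fin n → ℝ := fun i => if i < σ i then ((i : ℕ) + 1 : ℝ)
    else if σ i < i then -((σ i : ℕ) + 1 : ℝ) else 0
  have hw : ∀ i, w (σ i) = -w i := by
    intro i
    simp only [w, hσ]
    rcases lt_trichotomy i (σ i) with h | h | h
    · simp [h, h.not_gt]
    · rw [← h]; simp
    · simp [h, h.not_gt]
  have hw2 : ∀ i, w i ^ 2 = if σ i = i then 0 else (((min i (σ i) : Fin n) : ℕ) + 1 : ℝ) ^ 2 := by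
    intro i
    simp only [w]
    rcases lt_trichotomy i (σ i) with h | h | h
    · rw [if_pos h, if_neg h.ne', min_eq_left h.le]
    · rw [← h]; simp
    · rw [if_neg h.not_gt, if_pos h, if_neg h.ne, min_eq_right h.le, neg_sq]
  have hsep : ∀ i j, blk i = blk j → w i ^ 2 = w j ^ 2 → j = i ∨ j = σ i := by
    intro i j hbij h
    rw [hw2, hw2] at h
    split_ifs at h with h1 h2 h2
    · exact Or.inl (hf _ _ h2 h1 hbij.symm)
    · exfalso
      have : (0 : ℝ) < (((min j (σ j) : Fin n) : ℕ) + 1 : ℝ) ^ 2 := by positivity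
      linarith
    · exfalso
      have : (0 : ℝ) < (((min i (σ i) : Fin n) : ℕ) + 1 : ℝ) ^ 2 := by positivity
      linarith
    · rw [sq_eq_sq₀ (by positivity) (by positivity), add_left_inj, Nat.cast_inj] at h
      have h := Fin.ext h
      rcases min_choice i (σ i) with h3 | h3 <;> rcases min_choice j (σ j) with h4 | h4 <;>
        rw [h3, h4] at h
      · exact Or.inl h.symm
      · right; rw [h, hσ]
      · right; exact h.symm
      · left; rw [← hσ j, ← h, hσ]
  have hMB : pairMat σ w ∈ soB blk := by
    refine ⟨pairMat_skew hσ hw, fun i j h => ?_⟩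
    simp only [pairMat, Matrix.of_apply]
    rw [if_neg]
    rintro rfl
    exact h (hb i).symm
  refine ⟨pairMat σ w, hMB, le_trans ?_ (card_lt_invol blk σ hσ hb)⟩
  let L : soB blk →ₗ[ℝ] ({i // i < σ i} → ℝ) :=
    { toFun := fun X i => X.1 i.1 (σ i.1)
      map_add' := fun X Y => rfl
      map_smul' := fun c X => rfl }
  refine finrank_le_aux _ L ?_
  · intro X hX hLX
    have hc := rad_comm hMB X hX
    have hXB := mem_soB.1 X.2
    have hsk : ∀ i j, X.1 j i = - X.1 i j := fun i j => by
      have := congrFun (congrFun hXB.1 i) j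
      simpa using this
    have e1 : ∀ i j, w i * X.1 (σ i) j = - w j * X.1 i (σ j) := by
      intro i j
      have := congrFun (congrFun hc i) j
      rw [mul_apply, mul_apply, Finset.sum_eq_single (σ i), Finset.sum_eq_single (σ j)] at this
      · simp only [pairMat, Matrix.of_apply, hσ, if_true, hw] at this
        rw [this]; ring
      · intro k _ hk
        simp only [pairMat, Matrix.of_apply]
        rw [if_neg, mul_zero]
        rintro rfl
        exact hk (hσ k).symm
      · simp
      · intro k _ hk
        simp only [pairMat, Matrix.of_apply]
        rw [if_neg hk, zero_mul]
      · simp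
    have e2 : ∀ i j, X.1 i j ≠ 0 → w i ^ 2 = w j ^ 2 := by
      intro i j h
      have a1 := e1 i (σ j)
      have a2 := e1 (σ i) j
      rw [hσ, hw] at a1 a2
      have : (w i ^ 2 - w j ^ 2) * X.1 i j = 0 := by
        linear_combination w j * a1 - w i * a2
      rcases mul_eq_zero.1 this with h' | h'
      · linarith
      · exact absurd h' h
    apply Subtype.ext
    ext i j
    show X.1 i j = 0
    by_contra hne
    have hbij : blk i = blk j := by
      by_contra h
      exact hne (hXB.2 i j h)
    rcases hsep i j hbij (e2 i j hne) with h | h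
    · subst h
      have := hsk j j
      exact hne (by linarith)
    · subst h
      rcases lt_trichotomy i (σ i) with h | h | h
      · exact hne (congrFun hLX ⟨i, h⟩)
      · rw [← h] at hne
        have := hsk i i
        exact hne (by linarith)
      · have h5 : X.1 (σ i) (σ (σ i)) = 0 := congrFun hLX ⟨σ i, by rwa [hσ]⟩
        rw [hσ] at h5
        rw [hsk, h5, neg_zero] at hne
        exact hne rfl

open Matrix

lemma open_dense_of {n : ℕ} (f : Matrix (Fin n) (Fin n) ℝ → ℝ) (hc : Continuous f)
    (hp : ∀ M X, RPoly fun t => f (M + t • X)) (M0 : Matrix (Fin n) (Fin n) ℝ)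
    (hM0 : M0ᵀ = -M0) (h0 : f M0 ≠ 0) :
    IsOpen {M : {X : Matrix (Fin n) (Fin n) ℝ // Xᵀ = -X} | f M.1 ≠ 0} ∧
    Dense {M : {X : Matrix (Fin n) (Fin n) ℝ // Xᵀ = -X} | f M.1 ≠ 0} := by
  refine ⟨isOpen_ne_fun (hc.comp continuous_subtype_val) continuous_const, fun M => ?_⟩
  let γ : ℝ → {X : Matrix (Fin n) (Fin n) ℝ // Xᵀ = -X} := fun t => ⟨M.1 + t • (M0 - M.1), by
    rw [transpose_add, transpose_smul, transpose_sub, hM0, M.2]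
    module⟩
  have hγ : Continuous γ := by
    refine Continuous.subtype_mk ?_ _
    fun_prop
  have hγ0 : γ 0 = M := Subtype.ext (by simp [γ])
  have hfin : {t | f (M.1 + t • (M0 - M.1)) = 0}.Finite :=
    (hp M.1 (M0 - M.1)).finite (a := 1) (by simpa using h0)
  have hd : Dense ({t | f (M.1 + t • (M0 - M.1)) = 0}ᶜ) := hfin.countable.dense_compl ℝ
  have := map_mem_closure hγ (hd 0)
    (t := {M : {X : Matrix (Fin n) (Fin n) ℝ // Xᵀ = -X} | f M.1 ≠ 0}) (fun t ht => ht)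
  rwa [hγ0] at this

lemma rank_cont {n : ℕ} {κ : Type} [Fintype κ] [DecidableEq κ] (a : Fin n → ℝ)
    (X : κ → Matrix (Fin n) (Fin n) ℝ) (x y : κ → ℝ) :
    Continuous fun M => (rankMat a X x y M).det := by
  refine Continuous.matrix_det ?_
  refine continuous_matrix fun i j => ?_
  simp only [rankMat, Matrix.of_apply]
  refine Continuous.matrix_trace ?_
  refine continuous_const.matrix_mul (Continuous.matrix_adjugate ?_)
  unfold pen
  fun_prop

lemma omega_cont {n d : ℕ} (V : Submodule ℝ (Matrix (Fin n) (Fin n) ℝ)) (ξ η : Fin d → V) :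
    Continuous fun M => (Matrix.of fun i j => omegaV V M (ξ i) (η j)).det := by
  refine Continuous.matrix_det ?_
  refine continuous_matrix fun i j => ?_
  simp only [omegaV_apply, Matrix.of_apply]
  refine Continuous.matrix_trace ?_
  exact continuous_id.matrix_mul continuous_const

lemma omega_poly {n d : ℕ} (V : Submodule ℝ (Matrix (Fin n) (Fin n) ℝ)) (ξ η : Fin d → V)
    (M X : Matrix (Fin n) (Fin n) ℝ) :
    RPoly fun t => (Matrix.of fun i j => omegaV V (M + t • X) (ξ i) (η j)).det := by
  refine RPoly.det fun i j => ?_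
  simp only [omegaV_apply, Matrix.of_apply]
  exact RPoly.trace (RPoly.matmul (rpoly_line M X) fun _ _ => RPoly.const _)

lemma rad_generic {n : ℕ} {β : Type} [Fintype β] [DecidableEq β] (blk : Fin n → β) :
    ∃ U : Set {X : Matrix (Fin n) (Fin n) ℝ // Xᵀ = -X}, IsOpen U ∧ Dense U ∧ ∀ M ∈ U,
      Module.finrank ℝ (LinearMap.ker (omegaV (soB blk) M.1)) ≤
      ∑ p, (Finset.univ.filter fun i => blk i = p).card / 2 := by
  obtain ⟨M0, hM0, hle⟩ := generic_elem blk
  obtain ⟨d, ξ, η, hd, hdet⟩ := minor_exists (omegaV (soB blk) M0)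
  obtain ⟨h1, h2⟩ := open_dense_of _ (omega_cont (soB blk) ξ η) (omega_poly (soB blk) ξ η) M0
    hM0.1 hdet
  refine ⟨_, h1, h2, fun M hM => ?_⟩
  have := minor_bound (omegaV (soB blk) M.1) d ξ η hM
  omega

lemma exists_U {n r : ℕ} (α : Fin r → ℝ) (hα : Function.Injective α) (blk : Fin n → Fin r) :
    ∃ U : Set {X : Matrix (Fin n) (Fin n) ℝ // Xᵀ = -X}, IsOpen U ∧ Dense U ∧ ∀ M ∈ U,
      Module.finrank ℝ (LinearMap.ker (omegaV (soB fun _ : Fin n => ()) M.1)) ≤ n / 2 ∧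
      Module.finrank ℝ (LinearMap.ker (omegaV (soB blk) M.1)) ≤
        ∑ p, (Finset.univ.filter fun i => blk i = p).card / 2 ∧
      ∃ (κ : Type) (_ : Fintype κ) (_ : DecidableEq κ),
        (∃ X : κ → Matrix (Fin n) (Fin n) ℝ, (∀ i, (X i)ᵀ = -X i) ∧
          ∃ x y, (rankMat (fun i => α (blk i)) X x y M.1).det ≠ 0) ∧
        n.choose 2 + n / 2 + ∑ p, (Finset.univ.filter fun i => blk i = p).card / 2 ≤
        2 * Fintype.card κ + ∑ p, (Finset.univ.filter fun i => blk i = p).card.choose 2 := by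
  obtain ⟨U1, o1, d1, H1⟩ := rad_generic (fun _ : Fin n => ())
  obtain ⟨U2, o2, d2, H2⟩ := rad_generic blk
  obtain ⟨κ, i1, i2, ⟨M0, hM0, X, hX, x, y, hd⟩, hκ⟩ := rank_main α hα n blk
  obtain ⟨o3, d3⟩ := open_dense_of _ (rank_cont (fun i => α (blk i)) X x y)
    (fun M Z => rpoly_rankMat _ X (rpoly_line M Z) (fun _ => .const _) (fun _ => .const _)) M0 hM0 hd
  refine ⟨U1 ∩ (U2 ∩ _), o1.inter (o2.inter o3),
    d1.inter_of_isOpen_left (d2.inter_of_isOpen_left d3 o2) o1, ?_⟩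
  rintro M ⟨m1, m2, m3⟩
  refine ⟨by simpa using H1 M m1, H2 M m2, κ, i1, i2, ⟨X, hX, x, y, m3⟩, hκ⟩

open Matrix

lemma inv_poly {n : ℕ} (N : Matrix (Fin n) (Fin n) ℝ) (h : N.det ≠ 0) :
    ∃ p : Polynomial ℝ, N⁻¹ = Polynomial.aeval N p := by
  have h0 : N.charpoly.coeff 0 ≠ 0 := by
    have := Matrix.det_eq_sign_charpoly_coeff N
    intro h'
    rw [h', mul_zero] at this
    exact h this
  refine ⟨Polynomial.C (-(N.charpoly.coeff 0)⁻¹) * N.charpoly.divX, ?_⟩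
  apply Matrix.inv_eq_right_inv
  have h1 := Matrix.aeval_self_charpoly N
  rw [← Polynomial.divX_mul_X_add N.charpoly, map_add, map_mul, Polynomial.aeval_X,
    Polynomial.aeval_C] at h1
  have h2 : N * Polynomial.aeval N N.charpoly.divX = Polynomial.aeval N N.charpoly.divX * N := by
    have := congrArg (Polynomial.aeval N) (mul_comm Polynomial.X N.charpoly.divX)
    rwa [map_mul, map_mul, Polynomial.aeval_X] at this
  rw [map_mul, Polynomial.aeval_C, Algebra.algebraMap_eq_smul_one, smul_mul_assoc, one_mul,
    mul_smul_comm, h2, eq_neg_of_add_eq_zero_left h1, Algebra.algebraMap_eq_smul_one, smul_neg,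
    neg_smul, neg_neg, smul_smul, inv_mul_cancel₀ h0, one_smul]

noncomputable def skewPartL (n : ℕ) : Matrix (Fin n) (Fin n) ℝ →ₗ[ℝ] Matrix (Fin n) (Fin n) ℝ where
  toFun := skewPart
  map_add' := fun X Y => by simp only [skewPart, transpose_add]; module
  map_smul' := fun c X => by simp only [skewPart, transpose_smul, RingHom.id_apply]; module

lemma skewPartL_apply {n : ℕ} (X : Matrix (Fin n) (Fin n) ℝ) : skewPartL n X = skewPart X := rfl

lemma skewPart_skew {n : ℕ} (X : Matrix (Fin n) (Fin n) ℝ) : (skewPart X)ᵀ = - skewPart X := by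
  simp only [skewPart, transpose_smul, transpose_sub, transpose_transpose]; module

lemma L_diag {n r : ℕ} (α : Fin r → ℝ) (blk : Fin n → Fin r) (lam : ℝ) :
    lam • (1 : Matrix (Fin n) (Fin n) ℝ) + diagonal (fun i => α (blk i))
      = diagonal (fun i => lam + α (blk i)) := by
  rw [← diagonal_one, ← diagonal_smul, diagonal_add]
  simp

lemma L_det {n r : ℕ} (α : Fin r → ℝ) (blk : Fin n → Fin r) (lam : ℝ) (h : ∀ p, lam ≠ -α p) :
    IsUnit (lam • (1 : Matrix (Fin n) (Fin n) ℝ) + diagonal (fun i => α (blk i))).det := by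
  rw [L_diag, det_diagonal, isUnit_iff_ne_zero]
  refine Finset.prod_ne_zero_iff.2 fun i _ h' => h (blk i) (by linarith)

lemma adj_mem_good {n r : ℕ} (α : Fin r → ℝ) (blk : Fin n → Fin r)
    (M : Matrix (Fin n) (Fin n) ℝ) (x y : ℝ) (hx : x ≠ 0) (hy : ∀ p, y / x ≠ -α p)
    (hd : (pen (fun i => α (blk i)) M x y).det ≠ 0) :
    skewPart (pen (fun i => α (blk i)) M x y).adjugate ∈
      Submodule.span ℝ (pencilGradients α (diagonal fun i => α (blk i)) M) := by
  have hL := L_det α blk (y / x) hy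
  set L := (y / x) • (1 : Matrix (Fin n) (Fin n) ℝ) + diagonal (fun i => α (blk i)) with hLdef
  have hpen : pen (fun i => α (blk i)) M x y = (M * L⁻¹ + x • 1) * L := by
    rw [add_mul, Matrix.nonsing_inv_mul_cancel_right _ _ hL, smul_mul_assoc, one_mul, hLdef,
      smul_add, smul_smul, mul_div_cancel₀ _ hx, pen]
    abel
  set N := M * L⁻¹ + x • (1 : Matrix (Fin n) (Fin n) ℝ) with hN
  have hNd : N.det ≠ 0 := by
    intro h
    rw [hpen, det_mul, h, zero_mul] at hd
    exact hd rfl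
  obtain ⟨p, hp⟩ := inv_poly N hNd
  have hadj : (pen (fun i => α (blk i)) M x y).adjugate
      = (pen (fun i => α (blk i)) M x y).det • (L⁻¹ * Polynomial.aeval N p) := by
    rw [← hp, ← Matrix.mul_inv_rev, ← hpen, Matrix.inv_def, smul_smul,
      Ring.mul_inverse_cancel _ (isUnit_iff_ne_zero.2 hd), one_smul]
  rw [hadj, ← skewPartL_apply, map_smul]
  refine Submodule.smul_mem _ _ ?_
  have hN2 : N = Polynomial.aeval (M * L⁻¹) (Polynomial.X + Polynomial.C x) := by
    rw [map_add, Polynomial.aeval_X, Polynomial.aeval_C, Algebra.algebraMap_eq_smul_one]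
  rw [hN2, ← Polynomial.aeval_comp, Polynomial.aeval_eq_sum_range, Finset.mul_sum, map_sum]
  refine Submodule.sum_mem _ fun j _ => ?_
  rw [mul_smul_comm, map_smul]
  refine Submodule.smul_mem _ _ (Submodule.subset_span ?_)
  exact ⟨y / x, j, hy, rfl⟩

lemma mem_of_countable {n : ℕ} (J : Submodule ℝ (Matrix (Fin n) (Fin n) ℝ))
    (F : ℝ → Matrix (Fin n) (Fin n) ℝ) (hF : Continuous F) (s : Set ℝ) (hs : s.Countable)
    (h : ∀ y, y ∉ s → F y ∈ J) (y : ℝ) : F y ∈ J := by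
  have hcl : IsClosed (J : Set (Matrix (Fin n) (Fin n) ℝ)) := J.closed_of_finiteDimensional
  have h1 : IsClosed (F ⁻¹' (J : Set (Matrix (Fin n) (Fin n) ℝ))) := hcl.preimage hF
  have h2 : Dense (F ⁻¹' (J : Set (Matrix (Fin n) (Fin n) ℝ))) :=
    (hs.dense_compl ℝ).mono fun y hy => h y hy
  have h3 := h2.closure_eq
  rw [h1.closure_eq] at h3
  have : y ∈ F ⁻¹' (J : Set (Matrix (Fin n) (Fin n) ℝ)) := by rw [h3]; trivial
  exact this

lemma skew_adj_cont {n : ℕ} (a : Fin n → ℝ) (M : Matrix (Fin n) (Fin n) ℝ) (f g : ℝ → ℝ)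
    (hf : Continuous f) (hg : Continuous g) :
    Continuous fun t => skewPart (pen a M (f t) (g t)).adjugate := by
  have h1 : Continuous fun t => (pen a M (f t) (g t)).adjugate := by
    refine Continuous.matrix_adjugate ?_
    unfold pen
    fun_prop
  unfold skewPart
  exact (h1.sub h1.matrix_transpose).const_smul (1 / 2 : ℝ)

lemma pen_det_finite {n : ℕ} (a : Fin n → ℝ) (M : Matrix (Fin n) (Fin n) ℝ) (x : ℝ) :
    {y | (pen a M x y).det = 0}.Finite := by
  have hne : (-(M + x • diagonal a)).charpoly ≠ 0 := (Matrix.charpoly_monic _).ne_zero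
  refine (Polynomial.finite_setOfPred_isRoot hne).subset fun y hy => ?_
  have h2 : (Matrix.scalar (Fin n) y - -(M + x • diagonal a)) = pen a M x y := by
    rw [sub_neg_eq_add, add_comm, pen]
    congr 1
    ext i j
    simp [Matrix.scalar_apply, Matrix.one_apply, Matrix.diagonal_apply]
  change Polynomial.eval y _ = 0
  rw [Matrix.eval_charpoly, h2]
  exact hy

lemma adj_mem {n r : ℕ} (α : Fin r → ℝ) (blk : Fin n → Fin r)
    (M : Matrix (Fin n) (Fin n) ℝ) (x y : ℝ) :
    skewPart (pen (fun i => α (blk i)) M x y).adjugate ∈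
      Submodule.span ℝ (pencilGradients α (diagonal fun i => α (blk i)) M) := by
  have step1 : ∀ x y : ℝ, x ≠ 0 → skewPart (pen (fun i => α (blk i)) M x y).adjugate ∈
      Submodule.span ℝ (pencilGradients α (diagonal fun i => α (blk i)) M) := by
    intro x y hx
    have f1 := pen_det_finite (fun i => α (blk i)) M x
    have f2 : (Set.range fun p => - (x * α p)).Finite := Set.finite_range _
    refine mem_of_countable _ (fun y => skewPart (pen (fun i => α (blk i)) M x y).adjugate)
      (skew_adj_cont _ _ _ _ continuous_const continuous_id) _ (f1.union f2).countable ?_ y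
    intro y hy
    rw [Set.mem_union, not_or] at hy
    refine adj_mem_good α blk M x y hx (fun p hp => hy.2 ⟨p, ?_⟩) hy.1
    rw [div_eq_iff hx] at hp
    simp only [hp]; ring
  exact mem_of_countable _ (fun x => skewPart (pen (fun i => α (blk i)) M x y).adjugate)
      (skew_adj_cont _ _ _ _ continuous_id continuous_const) _ (Set.countable_singleton (0 : ℝ))
      (fun x hx => step1 x y hx) x

open Matrix

lemma eta_comm {n : ℕ} (M B : Matrix (Fin n) (Fin n) ℝ) (j : ℕ) :
    B * (M * B) ^ j = (B * M) ^ j * B := by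
  induction j with
  | zero => simp
  | succ j ih =>
    rw [pow_succ, ← mul_assoc, ih, pow_succ]
    simp only [mul_assoc]

lemma eta_transpose {n : ℕ} (M B : Matrix (Fin n) (Fin n) ℝ) (hM : Mᵀ = -M) (hB : Bᵀ = B)
    (j : ℕ) : (B * (M * B) ^ j)ᵀ = ((-1 : ℝ) ^ j) • (B * (M * B) ^ j) := by
  rw [transpose_mul, transpose_pow, transpose_mul, hM, hB, mul_neg, neg_pow, eta_comm]
  rcases Nat.even_or_odd j with h | h <;> simp [h.neg_one_pow]

lemma eta_skewPart {n : ℕ} (M B : Matrix (Fin n) (Fin n) ℝ) (hM : Mᵀ = -M) (hB : Bᵀ = B)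
    (j : ℕ) : ∃ c : ℝ, skewPart (B * (M * B) ^ j) = c • (B * (M * B) ^ j) := by
  refine ⟨(1/2) * (1 - (-1) ^ j), ?_⟩
  rw [skewPart, eta_transpose M B hM hB]
  module

lemma eta_ident {n : ℕ} (M B L : Matrix (Fin n) (Fin n) ℝ) (h1 : B * L = 1) (h2 : L * B = 1)
    (j : ℕ) : M * (B * (M * B) ^ j) * L = L * (B * (M * B) ^ j) * M := by
  have e1 : M * (B * (M * B) ^ j) * L = (M * B) ^ j * M := by
    rw [← mul_assoc, ← pow_succ', pow_succ, mul_assoc, mul_assoc M, h1, mul_one]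
  rw [e1, ← mul_assoc L, h2, one_mul]

/-- isotropy for distinct parameters -/
lemma isot_ne {n : ℕ} (M L1 L2 E1 E2 : Matrix (Fin n) (Fin n) ℝ) (c : ℝ) (hc : c ≠ 0)
    (hL : L1 - L2 = c • 1) (h1 : M * E1 * L1 = L1 * E1 * M) (h2 : M * E2 * L2 = L2 * E2 * M) :
    (M * (E1 * E2 - E2 * E1)).trace = 0 := by
  have hL1 : L1 = L2 + c • 1 := by rw [← hL]; abel
  -- compute trace (E2 * (M E1 L1 - L1 E1 M))
  have a1 : (E2 * (M * E1 * L1)).trace = (E2 * (L1 * E1 * M)).trace := by rw [h1]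
  have a2 : (E1 * (M * E2 * L2)).trace = (E1 * (L2 * E2 * M)).trace := by rw [h2]
  rw [hL1] at a1
  simp only [mul_add, add_mul, trace_add, mul_smul_comm, smul_mul_assoc, trace_smul, mul_one,
    one_mul, smul_eq_mul] at a1
  have b1 : (E1 * (M * E2 * L2)).trace = (E2 * (L2 * E1 * M)).trace := by
    rw [← mul_assoc, ← mul_assoc, trace_mul_comm, ← mul_assoc, ← mul_assoc,
      trace_mul_comm]
  have b2 : (E2 * (M * E1 * L2)).trace = (E1 * (L2 * E2 * M)).trace := by
    rw [trace_mul_comm]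
    simp only [mul_assoc]
    rw [trace_mul_comm]
    simp only [mul_assoc]
  have c1 : (M * (E1 * E2)).trace = (E2 * (M * E1)).trace := by
    rw [trace_mul_comm E2]; simp only [mul_assoc]
  have c2 : (M * (E2 * E1)).trace = (E2 * (E1 * M)).trace := by
    rw [trace_mul_comm M]; simp only [mul_assoc]
  rw [mul_sub, trace_sub, c1, c2]
  have : c * ((E2 * (M * E1)).trace - (E2 * (E1 * M)).trace) = 0 := by linarith
  exact (mul_eq_zero.1 this).resolve_left hc

lemma isot_eq {n : ℕ} (M B : Matrix (Fin n) (Fin n) ℝ) (i j : ℕ) :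
    (M * ((B * (M * B) ^ i) * (B * (M * B) ^ j) - (B * (M * B) ^ j) * (B * (M * B) ^ i))).trace
      = 0 := by
  have key : ∀ i j : ℕ, (M * ((B * (M * B) ^ i) * (B * (M * B) ^ j))).trace
      = (B * (M * B) ^ (i + j + 1)).trace := by
    intro i j
    have : M * ((B * (M * B) ^ i) * (B * (M * B) ^ j)) = (M * B) ^ (i + 1) * (B * (M * B) ^ j) := by
      rw [pow_succ']; simp only [mul_assoc]
    rw [this, trace_mul_comm, mul_assoc, ← pow_add]
    congr 3; omega
  rw [mul_sub, trace_sub, key, key, add_comm i j, sub_self]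

lemma isot_S {n : ℕ} (M B L E X : Matrix (Fin n) (Fin n) ℝ) (h1 : B * L = 1) (h2 : L * B = 1)
    (hE : M * E * L = L * E * M) (hX : X * L = L * X) :
    (M * (E * X - X * E)).trace = 0 := by
  have e1 : E * M = B * (M * E * L) := by rw [hE, ← mul_assoc, ← mul_assoc, h1, one_mul]
  have e2 : L * X * B = X := by rw [← hX, mul_assoc, h2, mul_one]
  have c1 : (M * (X * E)).trace = (M * (E * X)).trace := by
    rw [← mul_assoc, trace_mul_comm, ← mul_assoc, e1]
    rw [mul_assoc, trace_mul_comm]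
    have : M * E * L * X * B = M * (E * X) := by
      rw [mul_assoc (M * E), mul_assoc (M * E), e2, mul_assoc]
    rw [this]
  rw [mul_sub, trace_sub, c1, sub_self]

def perpS {n : ℕ} (M Y : Matrix (Fin n) (Fin n) ℝ) : Submodule ℝ (Matrix (Fin n) (Fin n) ℝ) where
  carrier := {X | (M * (X * Y - Y * X)).trace = 0}
  add_mem' := by
    intro a b ha hb
    simp only [Set.mem_ofPred_eq] at *
    have : M * ((a + b) * Y - Y * (a + b)) = M * (a * Y - Y * a) + M * (b * Y - Y * b) := by
      noncomm_ring
    rw [this, trace_add, ha, hb, add_zero]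
  zero_mem' := by simp
  smul_mem' := by
    intro c a ha
    simp only [Set.mem_ofPred_eq] at *
    have : M * ((c • a) * Y - Y * (c • a)) = c • (M * (a * Y - Y * a)) := by
      simp only [smul_mul_assoc, mul_smul_comm, ← smul_sub]
    rw [this, trace_smul, ha, smul_zero]

lemma mem_perpS {n : ℕ} (M Y X : Matrix (Fin n) (Fin n) ℝ) :
    X ∈ perpS M Y ↔ (M * (X * Y - Y * X)).trace = 0 := Iff.rfl

lemma perpS_symm {n : ℕ} (M Y X : Matrix (Fin n) (Fin n) ℝ) (h : X ∈ perpS M Y) :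
    Y ∈ perpS M X := by
  rw [mem_perpS] at *
  rw [← neg_sub, mul_neg, trace_neg, h, neg_zero]

lemma span_perp {n : ℕ} (M : Matrix (Fin n) (Fin n) ℝ) (s t : Set (Matrix (Fin n) (Fin n) ℝ))
    (h : ∀ X ∈ s, ∀ Y ∈ t, X ∈ perpS M Y) :
    ∀ X ∈ Submodule.span ℝ s, ∀ Y ∈ Submodule.span ℝ t, X ∈ perpS M Y := by
  have h1 : ∀ Y ∈ t, ∀ X ∈ Submodule.span ℝ s, X ∈ perpS M Y := fun Y hY X hX =>
    (Submodule.span_le (p := perpS M Y)).2 (fun X hX => h X hX Y hY) hX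
  intro X hX Y hY
  exact perpS_symm _ _ _ ((Submodule.span_le (p := perpS M X)).2
    (fun Y hY => perpS_symm _ _ _ (h1 Y hY X hX)) hY)

lemma span_soA {n r : ℕ} (α : Fin r → ℝ) (hα : Function.Injective α) (blk : Fin n → Fin r) :
    Submodule.span ℝ (soA (diagonal fun i => α (blk i))) = soB blk := by
  have : soA (diagonal fun i => α (blk i)) = (soB blk : Set (Matrix (Fin n) (Fin n) ℝ)) := by
    ext X
    rw [SetLike.mem_coe, mem_soB]
    refine and_congr Iff.rfl ?_
    constructor
    · intro h i j hij
      have := congrFun (congrFun h i) j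
      rw [mul_diagonal, diagonal_mul] at this
      have h2 : X i j * (α (blk j) - α (blk i)) = 0 := by linarith
      exact (mul_eq_zero.1 h2).resolve_right (sub_ne_zero.2 fun h => hij (hα h).symm)
    · intro h
      ext i j
      rw [mul_diagonal, diagonal_mul]
      by_cases hij : blk i = blk j
      · rw [hij, mul_comm]
      · rw [h i j hij, zero_mul, mul_zero]
  rw [this, Submodule.span_eq]

lemma soB_comm {n r : ℕ} (α : Fin r → ℝ) (blk : Fin n → Fin r) (lam : ℝ)
    (X : Matrix (Fin n) (Fin n) ℝ) (hX : X ∈ soB blk) :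
    X * (lam • (1 : Matrix (Fin n) (Fin n) ℝ) + diagonal (fun i => α (blk i)))
      = (lam • (1 : Matrix (Fin n) (Fin n) ℝ) + diagonal (fun i => α (blk i))) * X := by
  rw [L_diag]
  ext i j
  rw [mul_diagonal, diagonal_mul]
  by_cases hij : blk i = blk j
  · rw [hij, mul_comm]
  · rw [((mem_soB).1 hX).2 i j hij, zero_mul, mul_zero]

lemma L_inv_symm {n r : ℕ} (α : Fin r → ℝ) (blk : Fin n → Fin r) (lam : ℝ) :
    ((lam • (1 : Matrix (Fin n) (Fin n) ℝ) + diagonal (fun i => α (blk i)))⁻¹)ᵀ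
      = (lam • (1 : Matrix (Fin n) (Fin n) ℝ) + diagonal (fun i => α (blk i)))⁻¹ := by
  rw [transpose_nonsing_inv, L_diag, diagonal_transpose]

lemma J_isot {n r : ℕ} (α : Fin r → ℝ) (blk : Fin n → Fin r)
    (M : Matrix (Fin n) (Fin n) ℝ) (hM : Mᵀ = -M) :
    ∀ X ∈ Submodule.span ℝ (pencilGradients α (diagonal fun i => α (blk i)) M),
    ∀ Y ∈ Submodule.span ℝ (pencilGradients α (diagonal fun i => α (blk i)) M),
      X ∈ perpS M Y := by
  apply span_perp
  rintro _ ⟨l1, i, hl1, rfl⟩ _ ⟨l2, j, hl2, rfl⟩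
  obtain ⟨c, hc⟩ := eta_skewPart M _ hM (L_inv_symm α blk l1) i
  obtain ⟨d, hd⟩ := eta_skewPart M _ hM (L_inv_symm α blk l2) j
  rw [hc, hd]
  refine Submodule.smul_mem _ _ (perpS_symm _ _ _ (Submodule.smul_mem _ _ (perpS_symm _ _ _ ?_)))
  rw [mem_perpS]
  by_cases h : l1 = l2
  · subst h
    exact isot_eq _ _ _ _
  · have u1 := L_det α blk l1 hl1
    have u2 := L_det α blk l2 hl2
    refine isot_ne M _ _ _ _ (l1 - l2) (sub_ne_zero.2 h) ?_
      (eta_ident M _ _ (nonsing_inv_mul _ u1) (mul_nonsing_inv _ u1) i)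
      (eta_ident M _ _ (nonsing_inv_mul _ u2) (mul_nonsing_inv _ u2) j)
    rw [add_sub_add_right_eq_sub, ← sub_smul]

lemma J_S {n r : ℕ} (α : Fin r → ℝ) (blk : Fin n → Fin r)
    (M : Matrix (Fin n) (Fin n) ℝ) (hM : Mᵀ = -M) :
    ∀ X ∈ Submodule.span ℝ (pencilGradients α (diagonal fun i => α (blk i)) M),
    ∀ Y ∈ soB blk, X ∈ perpS M Y := by
  intro X hX Y hY
  refine (Submodule.span_le (p := perpS M Y)).2 ?_ hX
  rintro _ ⟨l1, i, hl1, rfl⟩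
  obtain ⟨c, hc⟩ := eta_skewPart M _ hM (L_inv_symm α blk l1) i
  rw [hc]
  refine Submodule.smul_mem _ _ ?_
  rw [mem_perpS]
  have u1 := L_det α blk l1 hl1
  exact isot_S M _ _ _ Y (nonsing_inv_mul _ u1) (mul_nonsing_inv _ u1)
    (eta_ident M _ _ (nonsing_inv_mul _ u1) (mul_nonsing_inv _ u1) i) (soB_comm α blk l1 Y hY)

lemma J_le {n r : ℕ} (α : Fin r → ℝ) (A M : Matrix (Fin n) (Fin n) ℝ) :
    Submodule.span ℝ (pencilGradients α A M) ≤ soB (fun _ : Fin n => ()) := by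
  rw [Submodule.span_le]
  rintro _ ⟨l1, i, hl1, rfl⟩
  exact mem_soB.2 ⟨skewPart_skew _, fun i j h => absurd rfl h⟩

lemma soB_le {n r : ℕ} (blk : Fin n → Fin r) : soB blk ≤ soB (fun _ : Fin n => ()) := by
  intro X hX
  exact mem_soB.2 ⟨(mem_soB.1 hX).1, fun i j h => absurd rfl h⟩

lemma trace_skewPart {n : ℕ} (X P : Matrix (Fin n) (Fin n) ℝ) (hX : Xᵀ = -X) :
    (X * skewPart P).trace = (X * P).trace := by
  have : (X * Pᵀ).trace = -(X * P).trace := by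
    rw [← trace_transpose, transpose_mul, transpose_transpose, hX, mul_neg, trace_neg,
      trace_mul_comm]
  rw [skewPart, mul_smul_comm, trace_smul, mul_sub, trace_sub, this, smul_eq_mul]
  ring

lemma J_card {n r : ℕ} (α : Fin r → ℝ) (blk : Fin n → Fin r)
    (M : Matrix (Fin n) (Fin n) ℝ) (κ : Type) [Fintype κ] [DecidableEq κ]
    (X : κ → Matrix (Fin n) (Fin n) ℝ) (hX : ∀ i, (X i)ᵀ = -X i) (x y : κ → ℝ)
    (h : (rankMat (fun i => α (blk i)) X x y M).det ≠ 0) :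
    Fintype.card κ ≤ Module.finrank ℝ
      (Submodule.span ℝ (pencilGradients α (diagonal fun i => α (blk i)) M)) := by
  let v : κ → Submodule.span ℝ (pencilGradients α (diagonal fun i => α (blk i)) M) :=
    fun j => ⟨_, adj_mem α blk M (x j) (y j)⟩
  let g : κ → (Submodule.span ℝ (pencilGradients α (diagonal fun i => α (blk i)) M)) →ₗ[ℝ] ℝ :=
    fun i => (traceLinearMap (Fin n) ℝ ℝ ∘ₗ LinearMap.mulLeft ℝ (X i)) ∘ₗ Submodule.subtype _
  have hv : LinearIndependent ℝ v := by
    apply lin_indep_of_det v g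
    rw [← det_transpose]
    convert h using 2
    ext i j
    exact trace_skewPart (X i) _ (hX i)
  exact hv.fintype_card_le_finrank

open Matrix

lemma abstract_coiso {E : Type} [AddCommGroup E] [Module ℝ E] [FiniteDimensional ℝ E]
    (B : E →ₗ[ℝ] E →ₗ[ℝ] ℝ) (J S : Submodule ℝ E)
    (hJJ : ∀ x ∈ J, ∀ y ∈ J, B x y = 0) (hJS : ∀ x ∈ J, ∀ y ∈ S, B x y = 0)
    (h : Module.finrank ℝ E + Module.finrank ℝ (LinearMap.ker B)
      + Module.finrank ℝ (J ⊓ S : Submodule ℝ E) ≤ 2 * Module.finrank ℝ J + Module.finrank ℝ S)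
    (ξ : E) (hξ : ∀ η ∈ J, B η ξ = 0) : ξ ∈ J ⊔ S := by
  have h1 := LinearMap.BilinForm.finrank_add_finrank_orthogonal' (B := B) J
  have h2 : Module.finrank ℝ (J ⊓ LinearMap.ker B : Submodule ℝ E)
      ≤ Module.finrank ℝ (LinearMap.ker B) := Submodule.finrank_mono inf_le_right
  have h3 := Submodule.finrank_sup_add_finrank_inf_eq J S
  have hle : J ⊔ S ≤ LinearMap.BilinForm.orthogonal B J :=
    sup_le (fun y hy x hx => hJJ x hx y hy) (fun y hy x hx => hJS x hx y hy)
  have heq := Submodule.eq_of_le_of_finrank_le hle (by omega)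
  rw [heq]
  exact fun x hx => hξ x hx

lemma finrank_comap_sub {E : Type} [AddCommGroup E] [Module ℝ E]
    (V J : Submodule ℝ E) (h : J ≤ V) :
    Module.finrank ℝ (J.comap V.subtype) = Module.finrank ℝ J :=
  (Submodule.comapSubtypeEquivOfLe h).finrank_eq

lemma inf_radical {n r : ℕ} (blk : Fin n → Fin r) (M : Matrix (Fin n) (Fin n) ℝ)
    (J : Submodule ℝ (Matrix (Fin n) (Fin n) ℝ))
    (hJS : ∀ X ∈ J, ∀ Y ∈ soB blk, X ∈ perpS M Y) :
    Module.finrank ℝ (J ⊓ soB blk : Submodule ℝ (Matrix (Fin n) (Fin n) ℝ))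
      ≤ Module.finrank ℝ (LinearMap.ker (omegaV (soB blk) M)) := by
  rw [← finrank_comap_sub (soB blk) (J ⊓ soB blk) inf_le_right]
  apply Submodule.finrank_mono
  intro X hX
  rw [LinearMap.mem_ker]
  ext Y
  exact hJS X.1 hX.1 Y.1 Y.2

lemma final_M {n r : ℕ} (α : Fin r → ℝ) (blk : Fin n → Fin r)
    (M : Matrix (Fin n) (Fin n) ℝ) (hM : Mᵀ = -M) 
    (h1 : Module.finrank ℝ (LinearMap.ker (omegaV (soB fun _ : Fin n => ()) M)) ≤ n / 2)
    (h2 : Module.finrank ℝ (LinearMap.ker (omegaV (soB blk) M))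
      ≤ ∑ p, (Finset.univ.filter fun i => blk i = p).card / 2)
    (κ : Type) [Fintype κ] [DecidableEq κ]
    (X : κ → Matrix (Fin n) (Fin n) ℝ) (hX : ∀ i, (X i)ᵀ = -X i) (x y : κ → ℝ)
    (h : (rankMat (fun i => α (blk i)) X x y M).det ≠ 0)
    (hnum : n.choose 2 + n / 2 + ∑ p, (Finset.univ.filter fun i => blk i = p).card / 2
      ≤ 2 * Fintype.card κ + ∑ p, (Finset.univ.filter fun i => blk i = p).card.choose 2)
    (ξ : Matrix (Fin n) (Fin n) ℝ) (hξ : ξᵀ = -ξ)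
    (hp : ∀ η ∈ Submodule.span ℝ (pencilGradients α (diagonal fun i => α (blk i)) M),
      (M * (ξ * η - η * ξ)).trace = 0) :
    ξ ∈ Submodule.span ℝ (pencilGradients α (diagonal fun i => α (blk i)) M) ⊔ soB blk := by
  have hc := J_card α blk M κ X hX x y h
  have hJ := J_le α (diagonal fun i => α (blk i)) M
  have hS := soB_le blk
  have hJJ := J_isot α blk M hM
  have hJS := J_S α blk M hM
  have hinf := inf_radical blk M _ hJS
  have hSd := finrank_soB blk
  have hV : Module.finrank ℝ (soB fun _ : Fin n => ()) = n.choose 2 := by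
    rw [finrank_soB]; simp
  generalize Submodule.span ℝ (pencilGradients α (diagonal fun i => α (blk i)) M) = J at *
  generalize soB blk = S at *
  generalize hVd : (soB fun _ : Fin n => ()) = V at *
  have hξV : ξ ∈ V := by
    rw [← hVd]; exact mem_soB.2 ⟨hξ, fun i j h => absurd rfl h⟩
  have key := abstract_coiso (omegaV V M)
    (J.comap V.subtype) (S.comap V.subtype)
    (fun X hX Y hY => hJJ X.1 hX Y.1 hY) (fun X hX Y hY => hJS X.1 hX Y.1 hY)
    (by
      have e1 : Module.finrank ℝ (J.comap V.subtype ⊓ S.comap V.subtype : Submodule ℝ V)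
          = Module.finrank ℝ (J ⊓ S : Submodule ℝ (Matrix (Fin n) (Fin n) ℝ)) := by
        rw [← Submodule.comap_inf]
        exact finrank_comap_sub V (J ⊓ S) (inf_le_left.trans hJ)
      rw [e1, finrank_comap_sub V J hJ, finrank_comap_sub V S hS, hV]
      omega)
    ⟨ξ, hξV⟩ (fun η hη => perpS_symm M _ _ (hp η.1 hη))
  obtain ⟨a, ha, b, hb, hab⟩ := Submodule.mem_sup.1 key
  refine Submodule.mem_sup.2 ⟨a.1, ha, b.1, hb, ?_⟩
  exact congrArg Subtype.val hab

/-- Bolsinov's completeness theorem, Theorem 2 of the paper: Let `A` be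
the block-scalar diagonal matrix with pairwise distinct values `α p` on consecutive
blocks of sizes `k 1, …, k r`, and for `M ∈ so(n)` let `J_M` be the span of the
gradients `π((λI + A)^{-1}(M(λI + A)^{-1})^j)`, `λ ∉ {−α 1, …, −α r}`. Then there is an
open dense subset `U` of `so(n)` such that for every `M ∈ U` the subspace
`J_M + so(n)_A` is coisotropic at `M`: every `ξ ∈ so(n)` with `tr(M·[ξ, η]) = 0` for
all `η ∈ J_M + so(n)_A` belongs to `J_M + so(n)_A`. -/
theorem pencil_integrals_plus_noether_complete (n r : ℕ) (k : Fin r → ℕ)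
    (hk : ∀ p, 0 < k p) (hsum : ∑ p, k p = n)
    (blk : Fin n → Fin r) (hmono : Monotone blk)
    (hcard : ∀ p, (Finset.univ.filter fun i => blk i = p).card = k p)
    (α : Fin r → ℝ) (hα : Function.Injective α)
    (A : Matrix (Fin n) (Fin n) ℝ) (hA : A = Matrix.diagonal fun i => α (blk i))
    (G : Matrix (Fin n) (Fin n) ℝ → Submodule ℝ (Matrix (Fin n) (Fin n) ℝ))
    (hG : ∀ M, G M = Submodule.span ℝ (pencilGradients α A M) ⊔ Submodule.span ℝ (soA A)) :
    ∃ U : Set {X : Matrix (Fin n) (Fin n) ℝ // Xᵀ = -X},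
      IsOpen U ∧ Dense U ∧
      ∀ M ∈ U, ∀ ξ : Matrix (Fin n) (Fin n) ℝ, ξᵀ = -ξ →
        (∀ η ∈ G M.1, ((M.1 : Matrix (Fin n) (Fin n) ℝ) * (ξ * η - η * ξ)).trace = 0) →
        ξ ∈ G M.1 := by
  subst hA
  obtain ⟨U, hU1, hU2, hU⟩ := exists_U α hα blk
  refine ⟨U, hU1, hU2, ?_⟩
  intro M hM ξ hξ hp
  obtain ⟨h1, h2, κ, i1, i2, ⟨X, hX, x, y, hdet⟩, hnum⟩ := hU M hM
  rw [hG, span_soA α hα blk] at hp ⊢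
  exact final_M α blk M.1 M.2 h1 h2 κ X hX x y hdet hnum ξ hξ
    fun η hη => hp η (Submodule.mem_sup_left hη)
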